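/- Let S ⊆ ℝⁿ (n ≥ 2) be a centrally symmetric convex body of class C²₊ (C² boundary with everywhere strictly positive Gauss curvature). Then there is a nonnegative function Ψ̃ with Ψ̃(δ) → 0 as δ → 0 such that for all sufficiently small δ > 0, (1 + (1 − Ψ̃(δ))·n^{2/(n+1)}·G_min·δ^{2/(n+1)})·S ⊆ S^δ ⊆ (1 + (1 + Ψ̃(δ))·n^{2/(n+1)}·G_max·δ^{2/(n+1)})·S. -/

import Mathlib

open MeasureTheory Metric Set Filter
open scoped RealInnerProductSpace Pointwise Topology

noncomputable section

abbrev Euc (n : ℕ) : Type := EuclideanSpace ℝ (Fin n)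

/-- A centrally symmetric convex body in `ℝⁿ`. -/
def IsSymConvexBody {n : ℕ} (S : Set (Euc n)) : Prop :=
  IsCompact S ∧ Convex ℝ S ∧ (interior S).Nonempty ∧ S = -S

/-- The convex floating body `K_δ`: the intersection of all closed halfspaces whose bounding
hyperplane cuts off a set of volume at most `δ·|K|ₙ` from `K`. -/
def floatingBody {n : ℕ} (K : Set (Euc n)) (δ : ℝ) : Set (Euc n) :=
  ⋂ (v : Euc n) (_ : v ≠ 0) (c : ℝ)
    (_ : volume (K ∩ {y | c ≤ ⟪v, y⟫}) ≤ ENNReal.ofReal δ * volume K),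
    {y | ⟪v, y⟫ ≤ c}

/-- The illumination body `K^δ`. -/
def illuminationBody {n : ℕ} (K : Set (Euc n)) (δ : ℝ) : Set (Euc n) :=
  {x | volume (convexHull ℝ (K ∪ {x})) ≤ ENNReal.ofReal (1 + δ) * volume K}

/-- The polar body `K°`. -/
def polarBody {n : ℕ} (K : Set (Euc n)) : Set (Euc n) :=
  {y | ∀ x ∈ K, ⟪x, y⟫ ≤ 1}

/-- The distance `d(C₁, C₂) = inf {a ≥ 1 : a⁻¹ C₁ ⊆ C₂ ⊆ a C₁}`. -/
def bodyDist {n : ℕ} (C₁ C₂ : Set (Euc n)) : ℝ :=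
  sInf {a : ℝ | 1 ≤ a ∧ a⁻¹ • C₁ ⊆ C₂ ∧ C₂ ⊆ a • C₁}

/-- `d_C(δ) = inf_{δ' > 0} d(C_δ, ((C°)^{δ'})°)`. -/
def dualDist {n : ℕ} (C : Set (Euc n)) (δ : ℝ) : ℝ :=
  sInf {r : ℝ | ∃ δ' > (0:ℝ), r = bodyDist (floatingBody C δ)
      (polarBody (illuminationBody (polarBody C) δ'))}

/-- `ν` is an outer unit normal of `S` at `x`. -/
def IsOuterNormalAt {n : ℕ} (S : Set (Euc n)) (x ν : Euc n) : Prop :=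
  ‖ν‖ = 1 ∧ ∀ y ∈ S, ⟪y, ν⟫ ≤ ⟪x, ν⟫

/-- Near `x ∈ ∂S`, the boundary of `S` is the graph of a `C²` function `f` over the tangent
hyperplane at `x` (embedded via a linear isometry `L` orthogonal to the normal `ν`), with
`f 0 = 0` and vanishing derivative at `0`, and `k` is the determinant of the Hessian of `f`
at `0`, i.e. the Gauss curvature of `∂S` at `x`. -/
def IsGaussCurvatureAt {n : ℕ} (S : Set (Euc n)) (x ν : Euc n) (k : ℝ) : Prop :=
  ∃ (L : Euc (n-1) →ₗᵢ[ℝ] Euc n) (f : Euc (n-1) → ℝ) (τ ε : ℝ),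
    0 < τ ∧ 0 < ε ∧
    (∀ v, ⟪L v, ν⟫ = 0) ∧
    ContDiffOn ℝ 2 f (ball 0 τ) ∧
    f 0 = 0 ∧ fderiv ℝ f 0 = 0 ∧
    frontier S ∩ ball x ε
      = {y | ∃ v ∈ ball (0 : Euc (n-1)) τ, y = x + L v - f v • ν} ∩ ball x ε ∧
    k = (Matrix.of fun i j : Fin (n-1) =>
      iteratedFDeriv ℝ 2 f 0 ![EuclideanSpace.single i 1, EuclideanSpace.single j 1]).det

/-- `S` has `C²` boundary, with outer unit normal map `u` and Gauss curvature function `κ`. -/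
def IsC2Body {n : ℕ} (S : Set (Euc n)) (u : Euc n → Euc n) (κ : Euc n → ℝ) : Prop :=
  ∀ x ∈ frontier S, IsOuterNormalAt S x (u x) ∧ IsGaussCurvatureAt S x (u x) (κ x)

/-- The constant `c(K, n) = ((n+1)^{2/(n+1)}/2)·(|K|ₙ/|B₂^{n−1}|_{n−1})^{2/(n+1)}`. -/
def cConst (n : ℕ) (K : Set (Euc n)) : ℝ :=
  ((n + 1 : ℝ) ^ ((2:ℝ)/(n+1)) / 2) *
    ((volume K).toReal / (volume (ball (0 : Euc (n-1)) 1)).toReal) ^ ((2:ℝ)/(n+1))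

/-- The function `G_S(x) = c(S,n)·κ(x)^{1/(n+1)} / ⟨x, u(x)⟩`. -/
def Gfun {n : ℕ} (S : Set (Euc n)) (u : Euc n → Euc n) (κ : Euc n → ℝ) (x : Euc n) : ℝ :=
  cConst n S * (κ x) ^ ((1:ℝ)/(n+1)) / ⟪x, u x⟫

/-- The integral over the centred ball of radius `R` in `ℝᵐ` of `β - ρ‖w‖ + c‖w‖²`. -/
def capPoly (m : ℕ) (R β ρ c : ℝ) : ℝ :=
  (volume (ball (0 : Euc m) 1)).toReal *
    (β * R ^ m - m / (m + 1) * ρ * R ^ (m + 1) + m / (m + 2) * c * R ^ (m + 2))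

lemma integral_indicator_cap {m : ℕ} (hm : 1 ≤ m) {R : ℝ} (hR : 0 ≤ R) (β ρ c : ℝ) :
    ∫ w : Euc m, (Iic R).indicator (fun y => β - ρ * y + c * y ^ 2) ‖w‖ = capPoly m R β ρ c := by
  have : Nontrivial (Euc m) := by
    have : Nonempty (Fin m) := ⟨⟨0, hm⟩⟩
    infer_instance
  rw [integral_fun_norm_addHaar]
  have hd : Module.finrank ℝ (Euc m) = m := by simp
  rw [hd]
  have h1 : ∫ y in Ioi (0:ℝ), y ^ (m - 1) • (Iic R).indicator (fun y => β - ρ * y + c * y ^ 2) y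
      = ∫ y in (0:ℝ)..R, (β * y ^ (m - 1) - ρ * y ^ m + c * y ^ (m + 1)) := by
    rw [intervalIntegral.integral_of_le hR, ← Ioi_inter_Iic, ← setIntegral_indicator measurableSet_Iic]
    refine setIntegral_congr_fun measurableSet_Ioi fun y _ => ?_
    by_cases hy : y ∈ Iic R
    · simp only [indicator_of_mem hy, smul_eq_mul]
      obtain ⟨k, rfl⟩ := Nat.exists_eq_add_of_le' hm
      simp only [Nat.add_sub_cancel]
      ring
    · simp [indicator_of_notMem hy]
  rw [h1, intervalIntegral.integral_add, intervalIntegral.integral_sub]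
  · simp only [intervalIntegral.integral_const_mul, integral_pow]
    obtain ⟨k, rfl⟩ := Nat.exists_eq_add_of_le' hm
    simp only [capPoly, Nat.add_sub_cancel, nsmul_eq_mul, smul_eq_mul, Measure.real]
    push_cast
    field_simp
    ring
  all_goals exact Continuous.intervalIntegrable (by fun_prop) _ _

lemma integrable_indicator_cap {m : ℕ} (R β ρ c : ℝ) :
    Integrable (fun w : Euc m => (Iic R).indicator (fun y => β - ρ * y + c * y ^ 2) ‖w‖) := by
  have h : IntegrableOn (fun w : Euc m => β - ρ * ‖w‖ + c * ‖w‖ ^ 2) (closedBall 0 R) :=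
    (by fun_prop : Continuous fun w : Euc m => β - ρ * ‖w‖ + c * ‖w‖ ^ 2).continuousOn.integrableOn_compact
      (isCompact_closedBall _ _)
  rw [← integrable_indicator_iff measurableSet_closedBall] at h
  refine h.congr (ae_of_all _ fun w => ?_)
  by_cases hw : ‖w‖ ≤ R <;> simp [indicator, hw]

lemma volume_cap_le {m : ℕ} (hm : 1 ≤ m) {R : ℝ} (hR : 0 ≤ R) (a b ρ c : ℝ)
    (h : ∀ y, 0 ≤ y → 0 ≤ (b - a) - ρ * y + c * y ^ 2) :
    volume {p : Euc m × ℝ | ‖p.1‖ ≤ R ∧ a - c * ‖p.1‖ ^ 2 ≤ p.2 ∧ p.2 ≤ b - ρ * ‖p.1‖}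
      ≤ ENNReal.ofReal (capPoly m R (b - a) ρ c) := by
  have hmeas : MeasurableSet
      {p : Euc m × ℝ | ‖p.1‖ ≤ R ∧ a - c * ‖p.1‖ ^ 2 ≤ p.2 ∧ p.2 ≤ b - ρ * ‖p.1‖} := by
    simp only [ofPred_and]
    exact (measurableSet_le (by fun_prop) (by fun_prop)).inter
      ((measurableSet_le (by fun_prop) (by fun_prop)).inter
        (measurableSet_le (by fun_prop) (by fun_prop)))
  rw [← integral_indicator_cap hm hR, ofReal_integral_eq_lintegral_ofReal
    (integrable_indicator_cap ..) (ae_of_all _ fun w => ?_), Measure.volume_eq_prod,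
    Measure.prod_apply hmeas]
  · refine lintegral_mono fun w => ?_
    by_cases hw : ‖w‖ ≤ R
    · simp only [preimage_ofPred_eq, hw, true_and, indicator, mem_Iic, if_true]
      refine (Real.volume_Icc (a := a - c * ‖w‖ ^ 2) (b := b - ρ * ‖w‖)).le.trans ?_
      exact ENNReal.ofReal_le_ofReal (by linarith)
    · simp [hw]
  · exact indicator_apply_nonneg fun _ => h _ (norm_nonneg w)

lemma le_volume_cap {m : ℕ} (hm : 1 ≤ m) {R : ℝ} (hR : 0 ≤ R) (a b ρ c : ℝ) :
    ENNReal.ofReal (capPoly m R (b - a) ρ c) ≤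
    volume {p : Euc m × ℝ | ‖p.1‖ ≤ R ∧ a - c * ‖p.1‖ ^ 2 < p.2 ∧ p.2 ≤ b - ρ * ‖p.1‖} := by
  have hmeas : MeasurableSet
      {p : Euc m × ℝ | ‖p.1‖ ≤ R ∧ a - c * ‖p.1‖ ^ 2 < p.2 ∧ p.2 ≤ b - ρ * ‖p.1‖} := by
    simp only [ofPred_and]
    exact (measurableSet_le (by fun_prop) (by fun_prop)).inter
      ((measurableSet_lt (by fun_prop) (by fun_prop)).inter
        (measurableSet_le (by fun_prop) (by fun_prop)))
  have hne := integrable_indicator_cap (m := m) R (b - a) ρ c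
  rw [← integral_indicator_cap hm hR]
  refine (ENNReal.ofReal_le_ofReal (integral_mono hne hne.pos_part
    fun w => le_max_left _ _)).trans ?_
  rw [ofReal_integral_eq_lintegral_ofReal hne.pos_part (ae_of_all _ fun w => le_max_right _ _),
    Measure.volume_eq_prod, Measure.prod_apply hmeas]
  refine lintegral_mono fun w => ?_
  by_cases hw : ‖w‖ ≤ R
  · simp only [preimage_ofPred_eq, hw, true_and, indicator, mem_Iic, if_true]
    refine le_trans ?_ (Real.volume_Ioc (a := a - c * ‖w‖ ^ 2) (b := b - ρ * ‖w‖)).ge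
    rw [ENNReal.ofReal_max, ENNReal.ofReal_zero, max_eq_left zero_le]
    exact ENNReal.ofReal_le_ofReal (by linarith)
  · simp [hw]

lemma continuous_capPoly (m : ℕ) :
    Continuous fun q : ℝ × ℝ × ℝ × ℝ => capPoly m q.1 q.2.1 q.2.2.1 q.2.2.2 := by
  unfold capPoly
  fun_prop

lemma capPoly_tangent (m : ℕ) {ρ h : ℝ} (hm : 1 ≤ m) (h2 : ρ ^ 2 = 2 * h) :
    capPoly m ρ h ρ (1 / 2) =
      (volume (ball (0 : Euc m) 1)).toReal * ρ ^ (m + 2) / ((m + 1) * (m + 2)) := by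
  obtain rfl : h = ρ ^ 2 / 2 := by linarith
  unfold capPoly
  field_simp
  ring

/-- Local second order description of `S` near the boundary point `x₀` with normal `ν`: in the
linear coordinates `(W, ℓ x)` centred at a boundary point `x` near `x₀`, the body `S` is squeezed
between the paraboloids `s = -(1 ± η)/2 * ‖w‖²`. -/
structure IsLocalModel {n m : ℕ} (S : Set (Euc n)) (x₀ ν : Euc n) (k : ℝ)
    (W : Euc n →L[ℝ] Euc m) (ℓ : Euc n → Euc n →L[ℝ] ℝ) : Prop where
  continuousAt : ContinuousAt ℓ x₀
  apply_base : ∀ y, ℓ x₀ y = ⟪y, ν⟫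
  surjective : ∀ x w s, ∃ y, W y = w ∧ ℓ x y = s
  norm_le : ∃ K > 0, ∀ᶠ x in 𝓝 x₀, ∀ y, ‖y‖ ≤ K * (‖W y‖ + |ℓ x y|)
  volume_preimage : ∀ x z r, 0 < r → ∀ A : Set (Euc m × ℝ),
    volume {y | (r⁻¹ • W (y - z), ℓ x (y - z) / r ^ 2) ∈ A}
      = ENNReal.ofReal (r ^ (m + 2) / √k) * volume A
  eventually : ∀ η > 0, ∀ᶠ p : Euc n × Euc n in 𝓝 (x₀, x₀), p.1 ∈ frontier S →
    (p.2 ∈ S → ℓ p.1 (p.2 - p.1) ≤ -((1 - η) / 2 * ‖W (p.2 - p.1)‖ ^ 2)) ∧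
    (ℓ p.1 (p.2 - p.1) ≤ -((1 + η) / 2 * ‖W (p.2 - p.1)‖ ^ 2) → p.2 ∈ S)

section LocalModel

variable {n m : ℕ} {S : Set (Euc n)} {x₀ ν : Euc n} {k : ℝ}
  {W : Euc n →L[ℝ] Euc m} {ℓ : Euc n → Euc n →L[ℝ] ℝ}

lemma IsLocalModel.eq_zero_of_mem (M : IsLocalModel S x₀ ν k W ℓ) (hc : Convex ℝ S)
    (hx : x₀ ∈ frontier S) {e : Euc n} (h0 : x₀ ∈ S) (h1 : x₀ + e ∈ S) (h2 : x₀ - e ∈ S) :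
    e = 0 := by
  obtain ⟨K, hK, hK'⟩ := M.norm_le
  have hev := M.eventually (1 / 2) (by norm_num)
  have htend : Tendsto (fun τ : ℝ => ((x₀, x₀ + τ • e) : Euc n × Euc n)) (𝓝 0) (𝓝 (x₀, x₀)) := by
    have : Continuous (fun τ : ℝ => ((x₀, x₀ + τ • e) : Euc n × Euc n)) := by fun_prop
    simpa using this.tendsto 0
  have htend' : Tendsto (fun τ : ℝ => ((x₀, x₀ - τ • e) : Euc n × Euc n)) (𝓝 0) (𝓝 (x₀, x₀)) := by
    have : Continuous (fun τ : ℝ => ((x₀, x₀ - τ • e) : Euc n × Euc n)) := by fun_prop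
    simpa using this.tendsto 0
  have hpos : ∀ᶠ τ : ℝ in 𝓝[>] 0, τ ∈ Ioc (0:ℝ) 1 := Ioc_mem_nhdsGT one_pos
  obtain ⟨τ, ⟨hτ, ha⟩, hb⟩ := ((hpos.and (nhdsWithin_le_nhds (htend.eventually hev))).and
    (nhdsWithin_le_nhds (htend'.eventually hev))).exists
  have hp : x₀ + τ • e ∈ S := by
    have := hc.add_smul_sub_mem h0 h1 ⟨hτ.1.le, hτ.2⟩
    simpa using this
  have hm : x₀ - τ • e ∈ S := by
    have := hc.add_smul_sub_mem h0 h2 ⟨hτ.1.le, hτ.2⟩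
    simpa [sub_eq_add_neg] using this
  have ha := (ha hx).1 hp
  have hb := (hb hx).1 hm
  simp only [add_sub_cancel_left, sub_sub_cancel_left, map_neg, map_smul, norm_neg, smul_eq_mul,
    norm_smul, mul_pow] at ha hb
  have hτ2 : 0 < ‖τ‖ ^ 2 := pow_pos (norm_pos_iff.2 hτ.1.ne') 2
  have hW : ‖W e‖ ^ 2 = 0 := by
    have : ‖τ‖ ^ 2 * ‖W e‖ ^ 2 ≤ 0 := by linarith
    exact le_antisymm (nonpos_of_mul_nonpos_right this hτ2) (by positivity)
  rw [hW] at ha hb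
  have hl : ℓ x₀ e = 0 := by
    have : τ * ℓ x₀ e = 0 := by linarith
    exact (mul_eq_zero.1 this).resolve_left hτ.1.ne'
  have := hK'.self_of_nhds e
  simp only [hl, pow_eq_zero_iff two_ne_zero |>.1 hW, abs_zero, add_zero, mul_zero] at this
  exact norm_le_zero_iff.1 this

lemma exists_exit_point (hcl : IsClosed S) (hc : Convex ℝ S) {z p y : Euc n} (hp : p ∈ S)
    (hy : y ∈ segment ℝ z p) (hyS : y ∉ S) :
    ∃ q ∈ frontier S, q ∈ S ∧ (∃ κ ∈ Icc (0:ℝ) 1, y = z + κ • (q - z)) ∧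
      ∀ σ ∈ Ico (0:ℝ) 1, z + σ • (q - z) ∉ S := by
  rw [segment_eq_image'] at hy
  obtain ⟨κ, hκ, rfl⟩ := hy
  let A : Set ℝ := Icc 0 1 ∩ (fun τ : ℝ => z + τ • (p - z)) ⁻¹' S
  have hA : IsCompact A := isCompact_Icc.inter_right (hcl.preimage (by fun_prop))
  obtain ⟨τ, ⟨hτ, hτS⟩, hmin⟩ := hA.exists_isLeast ⟨1, ⟨by simp, by simpa using hp⟩⟩
  have hτS : z + τ • (p - z) ∈ S := hτS
  have hlt : κ < τ := by
    by_contra! hle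
    refine hyS ?_
    have h1 : τ < 1 := by
      rcases hτ.2.lt_or_eq with h | h
      · exact h
      · exfalso
        have : κ = τ := le_antisymm (h ▸ hκ.2) hle
        exact hyS (this ▸ hτS)
    have := hc.add_smul_sub_mem hτS hp (t := (κ - τ) / (1 - τ))
      ⟨div_nonneg (by linarith) (by linarith), (div_le_one (by linarith)).2 (by linarith [hκ.2])⟩
    convert this using 1
    have h1' : (1 - τ) ≠ 0 := by linarith
    match_scalars <;> field_simp <;> ring
  have hτ0 : 0 < τ := hκ.1.trans_lt hlt
  have hout : ∀ σ ∈ Ico (0:ℝ) 1, z + σ • (z + τ • (p - z) - z) ∉ S := by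
    intro σ hσ hmem
    have h1 : σ * τ ∈ A := by
      refine ⟨⟨mul_nonneg hσ.1 hτ0.le, mul_le_one₀ hσ.2.le hτ0.le hτ.2⟩, ?_⟩
      simpa [smul_smul] using hmem
    have := hmin h1
    nlinarith [hσ.2]
  refine ⟨z + τ • (p - z), ?_, hτS, ⟨κ / τ, ⟨div_nonneg hκ.1 hτ0.le, ?_⟩, ?_⟩, hout⟩
  · refine ⟨subset_closure hτS, fun hne => ?_⟩
    have hcont : Tendsto (fun σ : ℝ => z + σ • (z + τ • (p - z) - z)) (𝓝[<] 1)
        (𝓝 (z + τ • (p - z))) := by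
      have : Continuous (fun σ : ℝ => z + σ • (z + τ • (p - z) - z)) := by fun_prop
      simpa using this.tendsto 1 |>.mono_left nhdsWithin_le_nhds
    have h1 := hcont.eventually (mem_interior_iff_mem_nhds.1 hne)
    obtain ⟨σ, hσ, hσ'⟩ := (h1.and (Ico_mem_nhdsLT zero_lt_one)).exists
    exact hout σ hσ' hσ
  · exact (div_le_one hτ0).2 hlt.le
  · simp only [add_sub_cancel_left, smul_smul]
    rw [div_mul_cancel₀ _ hτ0.ne']

lemma eventually_near_of_midpoint (hS : IsCompact S)
    (hstrict : ∀ p ∈ S, p ≠ x₀ → (1 / 2 : ℝ) • (p + x₀) ∈ interior S) {ε : ℝ} (hε : 0 < ε) :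
    ∀ᶠ x : Euc n × ℝ in 𝓝 (x₀, 0), ∀ q ∈ S,
      (1 / 2 : ℝ) • (q + (1 + x.2 ^ 2) • x.1) ∉ S → ‖q - x₀‖ < ε := by
  have hK : IsCompact (S \ ball x₀ ε) := hS.diff isOpen_ball
  have h := hK.eventually_forall_of_forall_eventually (x₀ := ((x₀, 0) : Euc n × ℝ))
    (P := fun x q => (1 / 2 : ℝ) • (q + (1 + x.2 ^ 2) • x.1) ∈ S) ?_
  · filter_upwards [h] with x hx q hq hout
    by_contra! hle
    exact hout (hx q ⟨hq, by simpa [dist_eq_norm] using hle⟩)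
  · intro q hq
    have hcont : Continuous fun z : (Euc n × ℝ) × Euc n =>
      (1 / 2 : ℝ) • (z.2 + (1 + z.1.2 ^ 2) • z.1.1) := by fun_prop
    have h1 := hcont.tendsto ((x₀, 0), q)
    simp only [ne_eq, OfNat.ofNat_ne_zero, not_false_eq_true, zero_pow, add_zero, one_smul] at h1
    refine h1.eventually (mem_interior_iff_mem_nhds.1 (hstrict q hq.1 fun h => ?_))
    subst h
    exact hq.2 (mem_ball_self hε)

/-- A neighbourhood on which the local model holds with precision `ε`. -/
lemma IsLocalModel.exists_ball (M : IsLocalModel S x₀ ν k W ℓ) {ε : ℝ} (hε : 0 < ε) :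
    ∃ δ > 0, (∀ x ∈ ball x₀ δ, ∀ y ∈ ball x₀ δ, |ℓ x y - ⟪x₀, ν⟫| < ε ∧ (x ∈ frontier S →
      (y ∈ S → ℓ x (y - x) ≤ -((1 - ε) / 2 * ‖W (y - x)‖ ^ 2)) ∧
      (ℓ x (y - x) ≤ -((1 + ε) / 2 * ‖W (y - x)‖ ^ 2) → y ∈ S))) := by
  have hcont : ContinuousAt (fun p : Euc n × Euc n => ℓ p.1 p.2) (x₀, x₀) :=
    ContinuousAt.clm_apply (M.continuousAt.comp (x := (x₀, x₀)) continuousAt_fst) continuousAt_snd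
  have h1 : ∀ᶠ p : Euc n × Euc n in 𝓝 (x₀, x₀), |ℓ p.1 p.2 - ⟪x₀, ν⟫| < ε := by
    have := hcont.eventually (ball_mem_nhds _ hε)
    simpa [dist_eq_norm, M.apply_base] using this
  obtain ⟨δ, hδ, h⟩ := Metric.eventually_nhds_iff_ball.1 (h1.and (M.eventually ε hε))
  refine ⟨δ, hδ, fun x hx y hy => h (x, y) ?_⟩
  rw [← ball_prod_same]
  exact ⟨hx, hy⟩

def upperRadius (h ε : ℝ) : ℝ := √(2 * (h + ε) / (1 - ε)) + ε

def upperTop (h ε : ℝ) : ℝ := ε / 2 * (2 * (h + ε) / (1 - ε)) + ε + √(2 * h) * ε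

def upperBottom (h ε : ℝ) : ℝ :=
  -(h + ε + (1 + ε) / 2 * (2 * ε * upperRadius h ε + ε ^ 2))

/-- An outer approximation of the rescaled cap. -/
def upperCap (m : ℕ) (h ε : ℝ) : Set (Euc m × ℝ) :=
  {p | ‖p.1‖ ≤ upperRadius h ε ∧ upperBottom h ε - (1 + ε) / 2 * ‖p.1‖ ^ 2 ≤ p.2 ∧
    p.2 ≤ upperTop h ε - √(2 * h) * ‖p.1‖}

set_option maxHeartbeats 800000 in
lemma IsLocalModel.subset_upperCap (M : IsLocalModel S x₀ ν k W ℓ) (hS : IsCompact S)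
    (hc : Convex ℝ S) (hx₀ : x₀ ∈ frontier S) (hh : 0 < ⟪x₀, ν⟫)
    (hstrict : ∀ p ∈ S, p ≠ x₀ → (1 / 2 : ℝ) • (p + x₀) ∈ interior S)
    {ε : ℝ} (hε : 0 < ε) (hε1 : ε < 1) :
    ∀ᶠ x : Euc n × ℝ in 𝓝[frontier S] x₀ ×ˢ 𝓝[>] 0,
      convexHull ℝ (S ∪ {(1 + x.2 ^ 2) • x.1}) \ S ⊆
        {y | (x.2⁻¹ • W (y - (1 + x.2 ^ 2) • x.1), ℓ x.1 (y - (1 + x.2 ^ 2) • x.1) / x.2 ^ 2) ∈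
          upperCap m ⟪x₀, ν⟫ ε} := by
  set h := ⟪x₀, ν⟫ with hdef
  obtain ⟨δ, hδ, hball⟩ := M.exists_ball hε
  have hle : 𝓝[frontier S] x₀ ×ˢ 𝓝[>] (0:ℝ) ≤ 𝓝 (x₀, 0) := by
    rw [nhds_prod_eq]
    exact Filter.prod_mono nhdsWithin_le_nhds nhdsWithin_le_nhds
  have e1 := hle (eventually_near_of_midpoint hS hstrict hδ)
  have e2 : ∀ᶠ x : Euc n × ℝ in 𝓝 (x₀, 0), (1 + x.2 ^ 2) • x.1 ∈ ball x₀ δ := by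
    have : Continuous fun x : Euc n × ℝ => (1 + x.2 ^ 2) • x.1 := by fun_prop
    have := this.tendsto (x₀, 0)
    simp only [ne_eq, OfNat.ofNat_ne_zero, not_false_eq_true, zero_pow, add_zero, one_smul] at this
    exact this.eventually (ball_mem_nhds _ hδ)
  have e3 : ∀ᶠ x : Euc n × ℝ in 𝓝 (x₀, 0), ‖x.2 • W x.1‖ < ε := by
    have : Continuous fun x : Euc n × ℝ => ‖x.2 • W x.1‖ := by fun_prop
    have := this.tendsto (x₀, 0)
    simp only [zero_smul, norm_zero] at this
    exact this.eventually (Iio_mem_nhds hε)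
  have e4 : ∀ᶠ x : Euc n × ℝ in 𝓝[frontier S] x₀ ×ˢ 𝓝[>] (0:ℝ),
      (x.1 ∈ frontier S ∧ x.1 ∈ ball x₀ δ) ∧ 0 < x.2 := by
    have h1 : ∀ᶠ x in 𝓝[frontier S] x₀, x ∈ frontier S ∧ x ∈ ball x₀ δ :=
      Filter.Eventually.and self_mem_nhdsWithin (nhdsWithin_le_nhds (ball_mem_nhds _ hδ))
    have h2 : ∀ᶠ r : ℝ in 𝓝[>] 0, 0 < r := self_mem_nhdsWithin
    exact h1.prod_mk h2
  filter_upwards [e1, hle e2, hle e3, e4]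
  rintro ⟨x, r⟩ hnear hz ho ⟨⟨hxS, hx⟩, hr⟩ y ⟨hy, hyS⟩
  simp only at hnear hz ho hxS hx hr hy ⊢
  set z := (1 + r ^ 2) • x with hzdef
  have hne : S.Nonempty := ⟨x₀, hS.isClosed.frontier_subset hx₀⟩
  obtain ⟨p, hp, hyp⟩ : ∃ p ∈ S, y ∈ segment ℝ z p := by
    rw [union_singleton, convexHull_insert hne, hc.convexHull_eq] at hy
    simpa [convexJoin] using hy
  obtain ⟨q, hqf, hqS, ⟨κ, hκ, rfl⟩, hout⟩ := exists_exit_point hS.isClosed hc hp hyp hyS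
  have hq : q ∈ ball x₀ δ := by
    rw [mem_ball, dist_eq_norm]
    refine hnear q hqS ?_
    have := hout (1 / 2) (by norm_num)
    convert this using 2
    module
  have hconv := convex_ball x₀ δ
  have hyb : z + κ • (q - z) ∈ ball x₀ δ := hconv.add_smul_sub_mem hz hq hκ
  -- the exit point sees the apex
  have hsee : 0 ≤ ℓ q (z - q) := by
    by_contra! hneg
    set C := (1 + ε) / 2 * ‖W (z - q)‖ ^ 2 with hC
    have hC0 : 0 ≤ C := by positivity
    set a := -ℓ q (z - q) with ha
    have ha0 : 0 < a := by linarith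
    set τ := a / (a + C + 1)
    have hτ0 : 0 < τ := by positivity
    have hτ1 : τ ≤ 1 := (div_le_one (by positivity)).2 (by linarith)
    have hmem : q + τ • (z - q) ∈ ball x₀ δ := hconv.add_smul_sub_mem hq hz ⟨hτ0.le, hτ1⟩
    have hnot : q + τ • (z - q) ∉ S := by
      have := hout (1 - τ) ⟨by linarith, by linarith⟩
      convert this using 2
      module
    refine hnot (((hball q hq _ hmem).2 hqf).2 ?_)
    simp only [add_sub_cancel_left, map_smul, norm_smul, mul_pow, smul_eq_mul, Real.norm_eq_abs,
      sq_abs]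
    have h1 : τ * C ≤ a := by
      have : τ * (a + C + 1) = a := div_mul_cancel₀ _ (by positivity)
      nlinarith
    have h2 : (1 + ε) / 2 * (τ ^ 2 * ‖W (z - q)‖ ^ 2) = τ * (τ * C) := by rw [hC]; ring
    rw [h2]
    nlinarith
  have hr2 : 0 < r ^ 2 := by positivity
  have hzx : z - x = r ^ 2 • x := by rw [hzdef]; module
  set o := r • W x with hodef
  set a := r⁻¹ • W (q - z) with hadef
  set u := r⁻¹ • W (q - x) with hudef
  have hua : u = a + o := by
    have : q - x = (q - z) + r ^ 2 • x := by rw [← hzx]; abel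
    rw [hudef, hadef, hodef, this, map_add, map_smul, smul_add, smul_smul]
    congr 2
    field_simp
  have hWu : ‖W (q - x)‖ ^ 2 = r ^ 2 * ‖u‖ ^ 2 := by
    rw [hudef, norm_smul, mul_pow, norm_inv, Real.norm_eq_abs, inv_pow, sq_abs]
    field_simp
  have hqx : ℓ q q - h < ε := (abs_lt.1 (hball q hq q hq).1).2
  have hqx' : ℓ q x - h < ε := (abs_lt.1 (hball q hq x hx).1).2
  have hxx := abs_lt.1 (hball x hx x hx).1
  have hu2 : ‖u‖ ^ 2 ≤ 2 * (h + ε) / (1 - ε) := by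
    have h1 := ((hball q hq x hx).2 hqf).1 (hS.isClosed.frontier_subset hxS)
    have h2 : ℓ q (z - q) = ℓ q (x - q) + r ^ 2 * ℓ q x := by
      have : z - q = (x - q) + r ^ 2 • x := by rw [← hzx]; abel
      rw [this, map_add, map_smul, smul_eq_mul]
    rw [← neg_sub q x, map_neg, map_neg, norm_neg, hWu] at h1
    rw [← neg_sub q x, map_neg] at h2
    rw [le_div_iff₀ (by linarith)]
    have h3 : r ^ 2 * ((1 - ε) / 2 * ‖u‖ ^ 2) ≤ r ^ 2 * (h + ε) := by nlinarith
    have := le_of_mul_le_mul_left h3 hr2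
    linarith
  have hu : ‖u‖ ≤ √(2 * (h + ε) / (1 - ε)) := Real.le_sqrt_of_sq_le hu2
  have hau : ‖a‖ ≤ ‖u‖ + ε := by
    have : a = u - o := by rw [hua]; abel
    rw [this]
    exact (norm_sub_le _ _).trans (by linarith)
  have hau' : ‖a‖ ≤ upperRadius h ε := by unfold upperRadius; linarith
  set b := ℓ x (q - z) / r ^ 2 with hbdef
  have hb : b ≤ upperTop h ε - √(2 * h) * ‖a‖ := by
    have h1 := ((hball x hx q hq).2 hxS).1 hqS
    rw [hWu] at h1
    have h2 : ℓ x (q - z) = ℓ x (q - x) - r ^ 2 * ℓ x x := by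
      have : q - z = (q - x) - r ^ 2 • x := by rw [← hzx]; abel
      rw [this, map_sub, map_smul, smul_eq_mul]
    have h3 : b ≤ -((1 - ε) / 2 * ‖u‖ ^ 2) - ℓ x x := by
      rw [hbdef, div_le_iff₀ hr2, h2]
      linarith
    have hs : √(2 * h) ^ 2 = 2 * h := Real.sq_sqrt (by linarith)
    have hs0 := Real.sqrt_nonneg (2 * h)
    have h4 := sq_nonneg (√(2 * h) - ‖u‖)
    have h5 : √(2 * h) * ‖a‖ ≤ √(2 * h) * (‖u‖ + ε) := mul_le_mul_of_nonneg_left hau hs0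
    have h6 : ε / 2 * ‖u‖ ^ 2 ≤ ε / 2 * (2 * (h + ε) / (1 - ε)) :=
      mul_le_mul_of_nonneg_left hu2 (by linarith)
    unfold upperTop
    linarith
  have hw : r⁻¹ • W (z + κ • (q - z) - z) = κ • a := by
    rw [add_sub_cancel_left, map_smul, smul_comm]
  have hs : ℓ x (z + κ • (q - z) - z) / r ^ 2 = κ * b := by
    rw [add_sub_cancel_left, map_smul, smul_eq_mul, mul_div_assoc]
  have hna : ‖κ • a‖ = κ * ‖a‖ := by rw [norm_smul, Real.norm_of_nonneg hκ.1]
  have hTop : 0 ≤ upperTop h ε := by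
    have : 0 ≤ 2 * (h + ε) / (1 - ε) := div_nonneg (by linarith) (by linarith)
    unfold upperTop
    positivity
  have hwR : ‖κ • a‖ ≤ upperRadius h ε := by
    rw [hna]
    exact (mul_le_of_le_one_left (norm_nonneg _) hκ.2).trans hau'
  show _ ∧ _
  rw [hw, hs]
  refine ⟨hwR, ?_, ?_⟩
  · by_contra! hlt
    refine hyS (((hball x hx _ hyb).2 hxS).2 ?_)
    have e1 : z + κ • (q - z) - x = (z + κ • (q - z) - z) + r ^ 2 • x := by rw [← hzx]; abel
    have e2 : W (z + κ • (q - z) - x) = r • (κ • a + o) := by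
      rw [← hw, e1, map_add, map_smul, smul_add, smul_smul, smul_smul, mul_inv_cancel₀ hr.ne',
        one_smul, sq]
    have e3 : ℓ x (z + κ • (q - z) - x) = r ^ 2 * (κ * b + ℓ x x) := by
      rw [← hs, e1, map_add, map_smul, smul_eq_mul]
      field_simp
    rw [e2, e3, norm_smul, mul_pow, Real.norm_eq_abs, sq_abs]
    have h1 : ‖κ • a + o‖ ^ 2 ≤ (‖κ • a‖ + ε) ^ 2 := by
      gcongr
      exact (norm_add_le _ _).trans (by linarith)
    have h2 : κ * b + ℓ x x ≤ -((1 + ε) / 2 * ‖κ • a + o‖ ^ 2) := by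
      have h3 : (1 + ε) / 2 * ‖κ • a + o‖ ^ 2 ≤
          (1 + ε) / 2 * (‖κ • a‖ ^ 2 + 2 * ε * upperRadius h ε + ε ^ 2) := by
        refine mul_le_mul_of_nonneg_left (h1.trans ?_) (by linarith)
        linarith [mul_le_mul_of_nonneg_left hwR hε.le, add_sq ‖κ • a‖ ε]
      unfold upperBottom at hlt
      linarith
    linarith [mul_le_mul_of_nonneg_left h2 hr2.le]
  · rw [hna]
    nlinarith [hκ.1, hκ.2]

def lowerSlope (h ε : ℝ) : ℝ := (h + ε + (1 + ε) / 2 * (√(2 * h) + ε) ^ 2) / √(2 * h)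

/-- An inner approximation of the rescaled cap. -/
def lowerCap (m : ℕ) (h ε : ℝ) : Set (Euc m × ℝ) :=
  {p | ‖p.1‖ ≤ √(2 * h) ∧ -h + ε * (1 + √(2 * h)) - (1 - ε) / 2 * ‖p.1‖ ^ 2 < p.2 ∧
    p.2 ≤ 0 - lowerSlope h ε * ‖p.1‖}

set_option maxHeartbeats 800000 in
lemma IsLocalModel.lowerCap_subset (M : IsLocalModel S x₀ ν k W ℓ) (hh : 0 < ⟪x₀, ν⟫)
    {ε : ℝ} (hε : 0 < ε) (hε1 : ε < 1) :
    ∀ᶠ x : Euc n × ℝ in 𝓝[frontier S] x₀ ×ˢ 𝓝[>] 0,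
        {y | (x.2⁻¹ • W (y - (1 + x.2 ^ 2) • x.1), ℓ x.1 (y - (1 + x.2 ^ 2) • x.1) / x.2 ^ 2) ∈
          lowerCap m ⟪x₀, ν⟫ ε} ⊆ convexHull ℝ (S ∪ {(1 + x.2 ^ 2) • x.1}) \ S := by
  set h := ⟪x₀, ν⟫ with hdef
  obtain ⟨δ, hδ, hball⟩ := M.exists_ball hε
  obtain ⟨K, hK, hKev⟩ := M.norm_le
  set ρ := √(2 * h) with hρ
  have hρ0 : 0 < ρ := Real.sqrt_pos.2 (by linarith)
  have hρ2 : ρ ^ 2 = 2 * h := Real.sq_sqrt (by linarith)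
  set C := h + 1 + (ρ + 1) ^ 2 with hC
  have hle : 𝓝[frontier S] x₀ ×ˢ 𝓝[>] (0:ℝ) ≤ 𝓝 (x₀, 0) := by
    rw [nhds_prod_eq]
    exact Filter.prod_mono nhdsWithin_le_nhds nhdsWithin_le_nhds
  have e2 : ∀ᶠ x : Euc n × ℝ in 𝓝 (x₀, 0),
      ‖(1 + x.2 ^ 2) • x.1 - x₀‖ + K * (x.2 * ρ + x.2 ^ 2 * C) < δ := by
    have : Continuous fun x : Euc n × ℝ =>
      ‖(1 + x.2 ^ 2) • x.1 - x₀‖ + K * (x.2 * ρ + x.2 ^ 2 * C) := by fun_prop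
    have := this.tendsto (x₀, 0)
    simp only [ne_eq, OfNat.ofNat_ne_zero, not_false_eq_true, zero_pow, add_zero, one_smul,
      sub_self, norm_zero, zero_mul, mul_zero] at this
    exact this.eventually (Iio_mem_nhds hδ)
  have e3 : ∀ᶠ x : Euc n × ℝ in 𝓝 (x₀, 0), ‖x.2 • W x.1‖ < ε := by
    have : Continuous fun x : Euc n × ℝ => ‖x.2 • W x.1‖ := by fun_prop
    have := this.tendsto (x₀, 0)
    simp only [zero_smul, norm_zero] at this
    exact this.eventually (Iio_mem_nhds hε)
  have e4 : ∀ᶠ x : Euc n × ℝ in 𝓝[frontier S] x₀ ×ˢ 𝓝[>] (0:ℝ),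
      (x.1 ∈ frontier S ∧ x.1 ∈ ball x₀ δ ∧ ∀ y, ‖y‖ ≤ K * (‖W y‖ + |ℓ x.1 y|)) ∧ 0 < x.2 := by
    have h1 : ∀ᶠ x in 𝓝[frontier S] x₀, x ∈ frontier S ∧ x ∈ ball x₀ δ ∧
        ∀ y, ‖y‖ ≤ K * (‖W y‖ + |ℓ x y|) :=
      Filter.Eventually.and self_mem_nhdsWithin
        (nhdsWithin_le_nhds (Filter.Eventually.and (ball_mem_nhds _ hδ) hKev))
    have h2 : ∀ᶠ r : ℝ in 𝓝[>] 0, 0 < r := self_mem_nhdsWithin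
    exact h1.prod_mk h2
  filter_upwards [hle e2, hle e3, e4]
  rintro ⟨x, r⟩ hz ho ⟨⟨hxS, hx, hnorm⟩, hr⟩ y hy
  simp only at hz ho hxS hx hr hy hnorm ⊢
  set z := (1 + r ^ 2) • x with hzdef
  have hr2 : 0 < r ^ 2 := by positivity
  have hzx : z - x = r ^ 2 • x := by rw [hzdef]; module
  set o := r • W x with hodef
  set t := ℓ x x with ht
  have hxx : |t - h| < ε := (hball x hx x hx).1
  obtain ⟨hxx1, hxx2⟩ := abs_lt.1 hxx
  -- description of `S` near `x₀` in the rescaled coordinates centred at the apex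
  have hshift : ∀ v : Euc n, ∀ w s, W (v - z) = r • w → ℓ x (v - z) = r ^ 2 * s →
      W (v - x) = r • (w + o) ∧ ℓ x (v - x) = r ^ 2 * (s + t) := by
    intro v w s hw hs
    have e1 : v - x = (v - z) + r ^ 2 • x := by rw [← hzx]; abel
    rw [e1, map_add, map_add, map_smul, map_smul, hw, hs, smul_eq_mul]
    constructor
    · rw [hodef, smul_add, smul_smul, sq]
    · ring
  have hlocal : ∀ v : Euc n, ∀ w s, W (v - z) = r • w → ℓ x (v - z) = r ^ 2 * s →
      ‖w‖ ≤ ρ → |s| ≤ C → v ∈ ball x₀ δ := by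
    intro v w s hw hs hwρ hsC
    rw [mem_ball, dist_eq_norm]
    have h1 := hnorm (v - z)
    rw [hw, hs, norm_smul, abs_mul, abs_of_pos hr2, Real.norm_of_nonneg hr.le] at h1
    have h2 : K * (r * ‖w‖ + r ^ 2 * |s|) ≤ K * (r * ρ + r ^ 2 * C) := by gcongr
    have h3 : v - x₀ = (z - x₀) + (v - z) := by abel
    rw [h3]
    exact (norm_add_le _ _).trans_lt (by linarith)
  have hin : ∀ v : Euc n, ∀ w s, W (v - z) = r • w → ℓ x (v - z) = r ^ 2 * s →
      ‖w‖ ≤ ρ → |s| ≤ C → s + t ≤ -((1 + ε) / 2 * ‖w + o‖ ^ 2) → v ∈ S := by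
    intro v w s hw hs hwρ hsC hle
    refine ((hball x hx v (hlocal v w s hw hs hwρ hsC)).2 hxS).2 ?_
    obtain ⟨e1, e2⟩ := hshift v w s hw hs
    rw [e1, e2, norm_smul, mul_pow, Real.norm_eq_abs, sq_abs]
    linarith [mul_le_mul_of_nonneg_left hle hr2.le]
  have hno : ∀ w : Euc m, ‖w‖ ≤ ρ → ‖w + o‖ ^ 2 ≤ (ρ + ε) ^ 2 := by
    intro w hw
    gcongr
    exact (norm_add_le _ _).trans (by linarith)
  have hbd : h + ε + (1 + ε) / 2 * (ρ + ε) ^ 2 ≤ C := by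
    have h1 : (ρ + ε) ^ 2 ≤ (ρ + 1) ^ 2 := by gcongr
    have h2 : (1 + ε) / 2 * (ρ + ε) ^ 2 ≤ 1 * (ρ + ε) ^ 2 := by
      refine mul_le_mul_of_nonneg_right (by linarith) (by positivity)
    linarith
  -- the point itself
  obtain ⟨hw, hs1, hs2⟩ := hy
  set w := r⁻¹ • W (y - z) with hwdef
  set s := ℓ x (y - z) / r ^ 2 with hsdef
  simp only at hw hs1 hs2
  have hWy : W (y - z) = r • w := by rw [hwdef, smul_smul, mul_inv_cancel₀ hr.ne', one_smul]
  have hly : ℓ x (y - z) = r ^ 2 * s := by rw [hsdef]; field_simp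
  have hslope : lowerSlope h ε * ρ = h + ε + (1 + ε) / 2 * (ρ + ε) ^ 2 := by
    rw [lowerSlope, ← hρ]
    exact div_mul_cancel₀ _ hρ0.ne'
  have hslope0 : 0 ≤ lowerSlope h ε := by unfold lowerSlope; positivity
  have hs0 : s ≤ 0 := hs2.trans (by linarith [mul_nonneg hslope0 (norm_nonneg w)])
  have hw2 : ‖w‖ ^ 2 ≤ ρ ^ 2 := by gcongr
  have hsC : |s| ≤ C := by
    rw [abs_of_nonpos hs0]
    have : (1 - ε) / 2 * ‖w‖ ^ 2 ≤ 1 * ρ ^ 2 :=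
      mul_le_mul (by linarith) hw2 (by positivity) (by norm_num)
    nlinarith
  have hlow : ‖w‖ ^ 2 - 2 * ε * ρ ≤ ‖w + o‖ ^ 2 := by
    have h1 : ‖w‖ ≤ ‖w + o‖ + ‖o‖ := by
      simpa using norm_sub_le (w + o) o
    have h2 := norm_nonneg (w + o)
    rcases le_total ‖w‖ ε with h3 | h3
    · nlinarith [norm_nonneg w]
    · have : (‖w‖ - ε) ^ 2 ≤ ‖w + o‖ ^ 2 := by
        have : 0 ≤ ‖w‖ - ε := by linarith
        gcongr
        linarith
      nlinarith
  have hst : -((1 - ε) / 2 * ‖w + o‖ ^ 2) < s + t := by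
    have := mul_le_mul_of_nonneg_left hlow (by linarith : 0 ≤ (1 - ε) / 2)
    nlinarith [mul_pos hε hρ0]
  have hyS : y ∉ S := by
    intro hyS
    have h1 := ((hball x hx y (hlocal y w s hWy hly hw hsC)).2 hxS).1 hyS
    obtain ⟨e1, e2⟩ := hshift y w s hWy hly
    rw [e1, e2, norm_smul, mul_pow, Real.norm_eq_abs, sq_abs] at h1
    nlinarith [mul_lt_mul_of_pos_left hst hr2]
  refine ⟨?_, hyS⟩
  -- bottom point
  set sb := -t - (1 + ε) / 2 * ‖w + o‖ ^ 2 with hsb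
  obtain ⟨b, hb1, hb2⟩ := M.surjective x (r • w) (r ^ 2 * sb)
  have hno' := mul_le_mul_of_nonneg_left (hno w hw) (by linarith : 0 ≤ (1 + ε) / 2)
  have hpos' : 0 ≤ (1 + ε) / 2 * ‖w + o‖ ^ 2 := by positivity
  have hbS : z + b ∈ S := by
    refine hin (z + b) w sb (by simpa using hb1) (by simpa using hb2) hw ?_ (by rw [hsb]; linarith)
    rw [abs_le]
    constructor <;> nlinarith
  have hsbs : sb < s := by
    have : (1 - ε) / 2 * ‖w + o‖ ^ 2 ≤ (1 + ε) / 2 * ‖w + o‖ ^ 2 := by gcongr; linarith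
    linarith
  -- tangent point
  obtain ⟨p, hp1, hp2⟩ := M.surjective x (r • (ρ / ‖w‖) • w) (r ^ 2 * -(lowerSlope h ε * ρ))
  have hpn : ‖(ρ / ‖w‖) • w‖ ≤ ρ := by
    rw [norm_smul, norm_div, norm_norm, Real.norm_of_nonneg hρ0.le]
    rw [div_mul_eq_mul_div]
    exact div_le_of_le_mul₀ (norm_nonneg _) hρ0.le le_rfl
  have hpS : z + p ∈ S := by
    refine hin (z + p) _ _ (by rw [add_sub_cancel_left, hp1])
      (by rw [add_sub_cancel_left, hp2]) hpn ?_ ?_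
    · rw [abs_neg, abs_of_nonneg (by positivity), hslope]
      exact hbd
    · rw [hslope]
      have := mul_le_mul_of_nonneg_left (hno _ hpn) (by linarith : 0 ≤ (1 + ε) / 2)
      linarith
  set H := convexHull ℝ (S ∪ {z}) with hH
  have hHc : Convex ℝ H := convex_convexHull ℝ _
  have hSH : S ⊆ H := subset_union_left.trans (subset_convexHull ℝ _)
  have hzH : z ∈ H := subset_convexHull ℝ _ (by simp)
  set κ := ‖w‖ / ρ with hκ
  have hκ0 : 0 ≤ κ := by positivity
  have hκ1 : κ ≤ 1 := (div_le_one hρ0).2 hw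
  have htop : z + κ • p ∈ H := hHc.add_smul_mem hzH (hSH hpS) ⟨hκ0, hκ1⟩
  have hκw : κ • (r • (ρ / ‖w‖) • w) = r • w := by
    rcases eq_or_ne w 0 with h0 | h0
    · simp [h0]
    · rw [smul_comm κ r, smul_smul κ]
      have : κ * (ρ / ‖w‖) = 1 := by
        have := norm_ne_zero_iff.2 h0
        rw [hκ]; field_simp
      rw [this, one_smul]
  have hκs : κ * (lowerSlope h ε * ρ) = lowerSlope h ε * ‖w‖ := by rw [hκ]; field_simp
  set st := -(lowerSlope h ε * ‖w‖) with hstdef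
  have hsst : s ≤ st := by linarith
  set μ := (s - sb) / (st - sb) with hμ
  have hμ0 : 0 ≤ μ := div_nonneg (by linarith) (by linarith)
  have hμ1 : μ ≤ 1 := (div_le_one (by linarith)).2 (by linarith)
  have hμe : μ * (st - sb) = s - sb := div_mul_cancel₀ _ (by linarith)
  have hmem := hHc.add_smul_sub_mem (hSH hbS) htop ⟨hμ0, hμ1⟩
  have hWtop : W (κ • p) = r • w := by rw [map_smul, hp1, hκw]
  have hltop : ℓ x (κ • p) = r ^ 2 * st := by rw [map_smul, hp2, smul_eq_mul, hstdef, ← hκs]; ring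
  have hyeq : y - (z + b + μ • (z + κ • p - (z + b))) = 0 := by
    have e1 : y - (z + b + μ • (z + κ • p - (z + b))) = (y - z) - b - μ • (κ • p - b) := by module
    have eW : W ((y - z) - b - μ • (κ • p - b)) = 0 := by
      rw [map_sub W _ (μ • _), map_sub W (y - z), map_smul W μ, map_sub W (κ • p), hWtop, hb1, hWy]
      simp
    have eℓ : ℓ x ((y - z) - b - μ • (κ • p - b)) = 0 := by
      rw [map_sub (ℓ x) _ (μ • _), map_sub (ℓ x) (y - z), map_smul (ℓ x) μ, map_sub (ℓ x) (κ • p),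
        hltop, hb2, hly, smul_eq_mul]
      linear_combination (-r ^ 2) * hμe
    have := hnorm ((y - z) - b - μ • (κ • p - b))
    rw [eW, eℓ] at this
    rw [e1]
    simpa using this
  rw [sub_eq_zero.1 hyeq]
  exact hmem

/-- The limit of `r ^ (-(m + 2))` times the volume added to `S` by the point `(1 + r ^ 2) • x`, as
`x` tends to a boundary point at which the support function is `h` and the curvature is `k`. -/
def capLimit (m : ℕ) (h k : ℝ) : ℝ :=
  (volume (ball (0 : Euc m) 1)).toReal * √(2 * h) ^ (m + 2) / ((m + 1) * (m + 2)) / √k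

lemma capPoly_sqrt_eq (hm : 1 ≤ m) {h : ℝ} (hh : 0 < h) :
    capPoly m √(2 * h) h √(2 * h) (1 / 2) / √k = capLimit m h k := by
  rw [capPoly_tangent m hm (Real.sq_sqrt (by positivity)), capLimit]

lemma tendsto_capPoly_upper (hm : 1 ≤ m) {h : ℝ} (hh : 0 < h) (k : ℝ) :
    Tendsto (fun ε => capPoly m (upperRadius h ε) (upperTop h ε - upperBottom h ε) √(2 * h)
      ((1 + ε) / 2) / √k) (𝓝[>] 0) (𝓝 (capLimit m h k)) := by
  rw [← capPoly_sqrt_eq hm hh]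
  have h1 : ContinuousAt (upperRadius h) 0 := by
    unfold upperRadius
    fun_prop (disch := norm_num)
  have h2 : ContinuousAt (upperTop h) 0 := by
    unfold upperTop
    fun_prop (disch := norm_num)
  have h3 : ContinuousAt (upperBottom h) 0 := by
    unfold upperBottom
    fun_prop (disch := norm_num)
  have h4 : ContinuousAt (fun ε : ℝ => (upperRadius h ε, upperTop h ε - upperBottom h ε,
      √(2 * h), (1 + ε) / 2)) 0 := by fun_prop
  have h5 : ContinuousAt (fun ε => capPoly m (upperRadius h ε) (upperTop h ε - upperBottom h ε)
      √(2 * h) ((1 + ε) / 2) / √k) 0 :=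
    (ContinuousAt.comp (f := fun ε : ℝ => (upperRadius h ε, upperTop h ε - upperBottom h ε,
      √(2 * h), (1 + ε) / 2)) (continuous_capPoly m).continuousAt h4).div_const _
  convert h5.tendsto.mono_left nhdsWithin_le_nhds using 3
  simp [upperRadius, upperTop, upperBottom]

lemma tendsto_capPoly_lower (hm : 1 ≤ m) {h : ℝ} (hh : 0 < h) (k : ℝ) :
    Tendsto (fun ε => capPoly m √(2 * h) (0 - (-h + ε * (1 + √(2 * h)))) (lowerSlope h ε)
      ((1 - ε) / 2) / √k) (𝓝[>] 0) (𝓝 (capLimit m h k)) := by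
  rw [← capPoly_sqrt_eq hm hh]
  have h1 : ContinuousAt (lowerSlope h) 0 := by
    unfold lowerSlope
    fun_prop
  have h4 : ContinuousAt (fun ε : ℝ => (√(2 * h), 0 - (-h + ε * (1 + √(2 * h))), lowerSlope h ε,
      (1 - ε) / 2)) 0 := by fun_prop
  have h5 : ContinuousAt (fun ε => capPoly m √(2 * h) (0 - (-h + ε * (1 + √(2 * h))))
      (lowerSlope h ε) ((1 - ε) / 2) / √k) 0 :=
    (ContinuousAt.comp (f := fun ε : ℝ => (√(2 * h), 0 - (-h + ε * (1 + √(2 * h))),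
      lowerSlope h ε, (1 - ε) / 2)) (continuous_capPoly m).continuousAt h4).div_const _
  convert h5.tendsto.mono_left nhdsWithin_le_nhds using 3
  have hsq : √(2 * h) ^ 2 = 2 * h := Real.sq_sqrt (by positivity)
  have hpos : 0 < √(2 * h) := Real.sqrt_pos.2 (by positivity)
  have : lowerSlope h 0 = √(2 * h) := by
    rw [lowerSlope, div_eq_iff hpos.ne']
    linarith
  simp [this]

lemma IsLocalModel.eventually_volume_lt (M : IsLocalModel S x₀ ν k W ℓ) (hm : 1 ≤ m)
    (hS : IsCompact S) (hc : Convex ℝ S) (hx₀ : x₀ ∈ frontier S) (hh : 0 < ⟪x₀, ν⟫)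
    (hstrict : ∀ p ∈ S, p ≠ x₀ → (1 / 2 : ℝ) • (p + x₀) ∈ interior S)
    {B : ℝ} (hB : capLimit m ⟪x₀, ν⟫ k < B) :
    ∀ᶠ x : Euc n × ℝ in 𝓝[frontier S] x₀ ×ˢ 𝓝[>] 0,
      volume (convexHull ℝ (S ∪ {(1 + x.2 ^ 2) • x.1}) \ S) < ENNReal.ofReal (B * x.2 ^ (m + 2)) := by
  obtain ⟨ε, hεB, hε, hε1⟩ := (((tendsto_capPoly_upper hm hh k).eventually_lt_const hB).and
    (Ioo_mem_nhdsGT (zero_lt_one' ℝ))).exists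
  have hB0 : 0 < B := by
    refine lt_of_le_of_lt ?_ hB
    unfold capLimit; positivity
  have hr : ∀ᶠ x : Euc n × ℝ in 𝓝[frontier S] x₀ ×ˢ 𝓝[>] 0, 0 < x.2 :=
    tendsto_snd.eventually (f := fun x : Euc n × ℝ => x.2) self_mem_nhdsWithin
  filter_upwards [M.subset_upperCap hS hc hx₀ hh hstrict hε hε1, hr] with x hx hr
  refine (measure_mono hx).trans_lt ?_
  rw [M.volume_preimage x.1 _ x.2 hr]
  have hR : 0 ≤ upperRadius ⟪x₀, ν⟫ ε := by unfold upperRadius; positivity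
  have hb : ⟪x₀, ν⟫ ≤ upperTop ⟪x₀, ν⟫ ε - upperBottom ⟪x₀, ν⟫ ε := by
    have : 0 < 1 - ε := by linarith
    have h1 : 0 ≤ upperTop ⟪x₀, ν⟫ ε := by unfold upperTop; positivity
    have h2 : upperBottom ⟪x₀, ν⟫ ε ≤ -⟪x₀, ν⟫ := by
      unfold upperBottom
      have : 0 ≤ ε + (1 + ε) / 2 * (2 * ε * upperRadius ⟪x₀, ν⟫ ε + ε ^ 2) := by positivity
      linarith
    linarith
  have hle := volume_cap_le hm hR (upperBottom ⟪x₀, ν⟫ ε) (upperTop ⟪x₀, ν⟫ ε) √(2 * ⟪x₀, ν⟫)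
    ((1 + ε) / 2) (fun y hy => by
      have hsq : √(2 * ⟪x₀, ν⟫) ^ 2 = 2 * ⟪x₀, ν⟫ := Real.sq_sqrt (by positivity)
      nlinarith [sq_nonneg (√(2 * ⟪x₀, ν⟫) - y), mul_nonneg hε.le (sq_nonneg y)])
  refine (mul_le_mul_right hle _).trans_lt ?_
  rw [← ENNReal.ofReal_mul (by positivity)]
  refine (ENNReal.ofReal_lt_ofReal_iff (by positivity)).2 ?_
  rw [div_mul_eq_mul_div, mul_div_assoc, mul_comm]
  exact mul_lt_mul_of_pos_right hεB (by positivity)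

lemma IsLocalModel.eventually_lt_volume (M : IsLocalModel S x₀ ν k W ℓ) (hm : 1 ≤ m)
    (hh : 0 < ⟪x₀, ν⟫) {B : ℝ} (hB0 : 0 ≤ B) (hB : B < capLimit m ⟪x₀, ν⟫ k) :
    ∀ᶠ x : Euc n × ℝ in 𝓝[frontier S] x₀ ×ˢ 𝓝[>] 0,
      ENNReal.ofReal (B * x.2 ^ (m + 2)) < volume (convexHull ℝ (S ∪ {(1 + x.2 ^ 2) • x.1}) \ S) := by
  obtain ⟨ε, hεB, hε, hε1⟩ := (((tendsto_capPoly_lower hm hh k).eventually_const_lt hB).and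
    (Ioo_mem_nhdsGT (zero_lt_one' ℝ))).exists
  have hr : ∀ᶠ x : Euc n × ℝ in 𝓝[frontier S] x₀ ×ˢ 𝓝[>] 0, 0 < x.2 :=
    tendsto_snd.eventually (f := fun x : Euc n × ℝ => x.2) self_mem_nhdsWithin
  filter_upwards [M.lowerCap_subset hh hε hε1, hr] with x hx hr
  refine lt_of_lt_of_le ?_ (measure_mono hx)
  rw [M.volume_preimage x.1 _ x.2 hr]
  have hle := le_volume_cap hm (Real.sqrt_nonneg (2 * ⟪x₀, ν⟫))
    (-⟪x₀, ν⟫ + ε * (1 + √(2 * ⟪x₀, ν⟫))) 0 (lowerSlope ⟪x₀, ν⟫ ε) ((1 - ε) / 2)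
  refine lt_of_lt_of_le ?_ (mul_le_mul_right hle _)
  rw [← ENNReal.ofReal_mul (by positivity)]
  have hpos : 0 < x.2 ^ (m + 2) := by positivity
  have key : B * x.2 ^ (m + 2) < x.2 ^ (m + 2) / √k * capPoly m √(2 * ⟪x₀, ν⟫)
      (0 - (-⟪x₀, ν⟫ + ε * (1 + √(2 * ⟪x₀, ν⟫)))) (lowerSlope ⟪x₀, ν⟫ ε) ((1 - ε) / 2) := by
    rw [div_mul_eq_mul_div, mul_div_assoc, mul_comm]
    exact mul_lt_mul_of_pos_left hεB hpos
  exact (ENNReal.ofReal_lt_ofReal_iff (lt_of_le_of_lt (by positivity) key)).2 key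

end LocalModel

section Charts

variable {n m : ℕ} {S : Set (Euc n)} {x₀ ν : Euc n}

/-- The linear isometry `(v, s) ↦ L v + s • ν`. -/
def splitIsometry (L : Euc m →ₗᵢ[ℝ] Euc n) (hν : ‖ν‖ = 1) (hL : ∀ v, ⟪L v, ν⟫ = 0) :
    WithLp 2 (Euc m × ℝ) →ₗᵢ[ℝ] Euc n where
  toFun p := L p.fst + p.snd • ν
  map_add' p q := by simp [add_smul]; abel
  map_smul' c p := by simp [mul_smul]
  norm_map' p := by
    have h : ‖L p.fst + p.snd • ν‖ ^ 2 = ‖p‖ ^ 2 := by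
      rw [WithLp.prod_norm_sq_eq_of_L2, norm_add_sq_real, inner_smul_right, hL, norm_smul, hν]
      simp
    exact (sq_eq_sq₀ (norm_nonneg _) (norm_nonneg _)).1 h

/-- The linear isometric isomorphism `(v, s) ↦ L v + s • ν`. -/
def splitIsometryEquiv (L : Euc m →ₗᵢ[ℝ] Euc n) (hν : ‖ν‖ = 1) (hL : ∀ v, ⟪L v, ν⟫ = 0)
    (hmn : m + 1 = n) : WithLp 2 (Euc m × ℝ) ≃ₗᵢ[ℝ] Euc n :=
  (splitIsometry L hν hL).toLinearIsometryEquiv (by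
    rw [(WithLp.linearEquiv 2 ℝ (Euc m × ℝ)).finrank_eq]
    simp [hmn])

lemma splitIsometryEquiv_apply (L : Euc m →ₗᵢ[ℝ] Euc n) (hν : ‖ν‖ = 1) (hL : ∀ v, ⟪L v, ν⟫ = 0)
    (hmn : m + 1 = n) (p : WithLp 2 (Euc m × ℝ)) :
    splitIsometryEquiv L hν hL hmn p = L p.fst + p.snd • ν := rfl

lemma adjoint_apply_isometry (L : Euc m →ₗᵢ[ℝ] Euc n) (v : Euc m) :
    L.toContinuousLinearMap.adjoint (L v) = v := by
  refine ext_inner_right ℝ fun w => ?_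
  rw [ContinuousLinearMap.adjoint_inner_left]
  exact L.inner_map_map v w

lemma adjoint_apply_normal (L : Euc m →ₗᵢ[ℝ] Euc n) (hL : ∀ v, ⟪L v, ν⟫ = 0) :
    L.toContinuousLinearMap.adjoint ν = 0 := by
  refine ext_inner_right ℝ fun w => ?_
  rw [ContinuousLinearMap.adjoint_inner_left, inner_zero_left, real_inner_comm]
  exact hL w

lemma adjoint_decomposition (L : Euc m →ₗᵢ[ℝ] Euc n) (hν : ‖ν‖ = 1) (hL : ∀ v, ⟪L v, ν⟫ = 0)
    (hmn : m + 1 = n) (y : Euc n) : L (L.toContinuousLinearMap.adjoint y) + ⟪y, ν⟫ • ν = y := by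
  obtain ⟨p, rfl⟩ := (splitIsometryEquiv L hν hL hmn).surjective y
  rw [splitIsometryEquiv_apply, map_add, adjoint_apply_isometry, map_smul,
    adjoint_apply_normal L hL, inner_add_left, hL, real_inner_smul_left, real_inner_self_eq_norm_sq,
    hν]
  simp

lemma subset_or_disjoint_of_frontier {P : Set (Euc n)} (hP : IsPreconnected P)
    (h : Disjoint P (frontier S)) : P ⊆ S ∨ Disjoint P S := by
  have hnei : P ∩ S ⊆ interior S := fun y hy => by
    by_contra hyi
    exact disjoint_left.1 h hy.1 ⟨subset_closure hy.2, hyi⟩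
  have hext : P \ S ⊆ (closure S)ᶜ := fun y hy hyc =>
    disjoint_left.1 h hy.1 ⟨hyc, fun hyi => hy.2 (interior_subset hyi)⟩
  by_contra! hcon
  obtain ⟨⟨p, hp, hpS⟩, hq⟩ := hcon.imp_left not_subset.1
  obtain ⟨q, hqP, hqS⟩ := not_disjoint_iff.1 hq
  obtain ⟨z, -, hz⟩ := hP (interior S) (closure S)ᶜ isOpen_interior isClosed_closure.isOpen_compl
    (fun y hy => (em (y ∈ S)).imp (fun h => hnei ⟨hy, h⟩) fun h => hext ⟨hy, h⟩)
    ⟨q, hqP, hnei ⟨hqP, hqS⟩⟩ ⟨p, hp, hext ⟨hp, hpS⟩⟩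
  exact hz.2 (interior_subset_closure hz.1)

lemma eventually_mem_iff_graph (L : Euc m →ₗᵢ[ℝ] Euc n) (hν : ‖ν‖ = 1) (hL : ∀ v, ⟪L v, ν⟫ = 0)
    (hmn : m + 1 = n) (hcl : IsClosed S) (hc : Convex ℝ S) (hnei : (interior S).Nonempty)
    (hx₀ : x₀ ∈ frontier S) (hsupp : ∀ y ∈ S, ⟪y, ν⟫ ≤ ⟪x₀, ν⟫) {f : Euc m → ℝ} {τ ε : ℝ}
    (hτ : 0 < τ) (hε : 0 < ε) (hf : ContinuousOn f (ball 0 τ)) (hf0 : f 0 = 0)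
    (hfr : frontier S ∩ ball x₀ ε
      = {y | ∃ v ∈ ball (0 : Euc m) τ, y = x₀ + L v - f v • ν} ∩ ball x₀ ε) :
    ∀ᶠ y in 𝓝 x₀,
      (y ∈ S ↔ ⟪y - x₀, ν⟫ + f (L.toContinuousLinearMap.adjoint (y - x₀)) ≤ 0) ∧
      (y ∈ frontier S → ⟪y - x₀, ν⟫ + f (L.toContinuousLinearMap.adjoint (y - x₀)) = 0) := by
  set T := L.toContinuousLinearMap.adjoint with hT
  have hTL : ∀ v, T (L v) = v := adjoint_apply_isometry L
  have hTν : T ν = 0 := adjoint_apply_normal L hL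
  have hdec : ∀ y, L (T y) + ⟪y, ν⟫ • ν = y := adjoint_decomposition L hν hL hmn
  have hνν : ⟪ν, ν⟫ = 1 := by rw [real_inner_self_eq_norm_sq, hν]; norm_num
  have hf_at : ContinuousAt f 0 := hf.continuousAt (ball_mem_nhds _ hτ)
  let Φ : Euc m × ℝ → Euc n := fun p => x₀ + L p.1 - (f p.1 + p.2) • ν
  have hΦ0 : Φ (0, 0) = x₀ := by simp [Φ, hf0]
  have hΦc : ContinuousAt Φ (0, 0) := by
    have h1 : ContinuousAt (fun p : Euc m × ℝ => f p.1) (0, 0) :=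
      ContinuousAt.comp (f := fun p : Euc m × ℝ => p.1) hf_at continuousAt_fst
    have h2 : ContinuousAt (fun p : Euc m × ℝ => x₀ + L p.1) (0, 0) := by
      have : Continuous (fun p : Euc m × ℝ => x₀ + L p.1) := by fun_prop
      exact this.continuousAt
    exact h2.sub ((h1.add continuousAt_snd).smul continuousAt_const)
  obtain ⟨r₀, hr₀, hball⟩ := Metric.eventually_nhds_iff_ball.1
    (hΦc.eventually (by rw [hΦ0]; exact ball_mem_nhds x₀ hε))
  obtain ⟨r, hr, hrr₀, hrτ⟩ : ∃ r > 0, r ≤ r₀ ∧ r ≤ τ := ⟨min r₀ τ, by positivity, by simp, by simp⟩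
  have hballΦ : ∀ v σ, ‖v‖ < r → |σ| < r → Φ (v, σ) ∈ ball x₀ ε := by
    intro v σ hv hσ
    refine hball _ ?_
    rw [mem_ball, Prod.dist_eq, dist_zero_right, Real.dist_0_eq_abs]
    exact (max_lt hv hσ).trans_le hrr₀
  have hinner : ∀ v σ, ⟪Φ (v, σ) - x₀, ν⟫ = -(f v + σ) := by
    intro v σ
    have e : Φ (v, σ) - x₀ = L v - (f v + σ) • ν := by simp only [Φ]; abel
    rw [e]
    rw [inner_sub_left, hL, real_inner_smul_left, hνν]
    ring
  have hadj : ∀ v σ, T (Φ (v, σ) - x₀) = v := by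
    intro v σ
    have e : Φ (v, σ) - x₀ = L v - (f v + σ) • ν := by simp only [Φ]; abel
    rw [e, map_sub, map_smul, hTL, hTν]
    simp
  have hΦfr : ∀ v σ, ‖v‖ < r → |σ| < r → (Φ (v, σ) ∈ frontier S ↔ σ = 0) := by
    intro v σ hv hσ
    have hb := hballΦ v σ hv hσ
    constructor
    · intro h
      have : Φ (v, σ) ∈ frontier S ∩ ball x₀ ε := ⟨h, hb⟩
      rw [hfr] at this
      obtain ⟨⟨v', hv', he⟩, -⟩ := this
      have he' : Φ (v, σ) = Φ (v', 0) := by rw [he]; simp [Φ]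
      have h1 := hadj v σ
      rw [he', hadj] at h1
      have h2 := hinner v σ
      rw [he', hinner, h1] at h2
      linarith
    · rintro rfl
      have : Φ (v, 0) ∈ frontier S ∩ ball x₀ ε := by
        rw [hfr]
        exact ⟨⟨v, by simpa using hv.trans_le hrτ, by simp [Φ]⟩, hb⟩
      exact this.1
  have hpre : ∀ I : Set ℝ, Convex ℝ I → IsPreconnected (Φ '' (ball 0 r ×ˢ I)) := by
    intro I hI
    refine ((convex_ball (0 : Euc m) r).prod hI).isPreconnected.image _ ?_
    have h1 : ContinuousOn (fun p : Euc m × ℝ => f p.1) (ball 0 r ×ˢ I) :=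
      (hf.mono (ball_subset_ball hrτ)).comp continuousOn_fst fun p hp => hp.1
    have h2 : ContinuousOn (fun p : Euc m × ℝ => x₀ + L p.1) (ball 0 r ×ˢ I) := by fun_prop
    exact h2.sub ((h1.add continuousOn_snd).smul continuousOn_const)
  have hdis : ∀ I : Set ℝ, (∀ σ ∈ I, |σ| < r ∧ σ ≠ 0) →
      Disjoint (Φ '' (ball 0 r ×ˢ I)) (frontier S) := by
    intro I hI
    rw [disjoint_left]
    rintro _ ⟨⟨v, σ⟩, ⟨hv, hσ⟩, rfl⟩ h
    exact (hI σ hσ).2 ((hΦfr v σ (by simpa using hv) (hI σ hσ).1).1 h)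
  have hneg : Disjoint (Φ '' (ball 0 r ×ˢ Ioo (-r) 0)) S := by
    refine (subset_or_disjoint_of_frontier (hpre _ (convex_Ioo _ _)) (hdis _ fun σ hσ =>
      ⟨abs_lt.2 ⟨hσ.1, hσ.2.trans hr⟩, hσ.2.ne⟩)).resolve_left fun h => ?_
    have hmem : Φ (0, -(r / 2)) ∈ S :=
      h ⟨_, ⟨by simpa using hr, by constructor <;> linarith⟩, rfl⟩
    have h1 := hsupp _ hmem
    have h2 := hinner 0 (-(r / 2))
    rw [inner_sub_left, hf0] at h2
    linarith
  let σ' : Euc n → ℝ := fun y => -⟪y - x₀, ν⟫ - f (T (y - x₀))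
  have hσ'Φ : ∀ y, Φ (T (y - x₀), σ' y) = y := by
    intro y
    have := hdec (y - x₀)
    simp only [Φ, σ']
    have e : f (T (y - x₀)) + (-⟪y - x₀, ν⟫ - f (T (y - x₀))) = -⟪y - x₀, ν⟫ := by ring
    rw [e, neg_smul, sub_neg_eq_add, add_assoc, this]
    abel
  have hnhds : ∀ᶠ y in 𝓝 x₀, ‖T (y - x₀)‖ < r ∧ |σ' y| < r := by
    have h1 : ContinuousAt (fun y => T (y - x₀)) x₀ := by fun_prop
    have h2 : ContinuousAt (fun y => f (T (y - x₀))) x₀ :=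
      ContinuousAt.comp (f := fun y => T (y - x₀)) (by simpa using hf_at) h1
    have h3 : ContinuousAt σ' x₀ := by
      have : ContinuousAt (fun y : Euc n => -⟪y - x₀, ν⟫) x₀ := by fun_prop
      exact this.sub h2
    have e1 : ‖T (x₀ - x₀)‖ < r := by simpa using hr
    have e2 : |σ' x₀| < r := by simpa [σ', hf0] using hr
    exact (h1.norm.eventually_lt_const e1).and (h3.abs.eventually_lt_const e2)
  have hpos : Φ '' (ball 0 r ×ˢ Ioo 0 r) ⊆ S := by
    refine (subset_or_disjoint_of_frontier (hpre _ (convex_Ioo _ _)) (hdis _ fun σ hσ =>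
      ⟨abs_lt.2 ⟨by linarith [hσ.1], hσ.2⟩, hσ.1.ne'⟩)).resolve_right fun h => ?_
    have hcl' : x₀ ∈ closure (interior S) := by
      rw [hc.closure_interior_eq_closure_of_nonempty_interior hnei]
      exact frontier_subset_closure hx₀
    obtain ⟨y, hy, hyT, hyσ⟩ := ((mem_closure_iff_frequently.1 hcl').and_eventually hnhds).exists
    have hy0 : σ' y ≠ 0 := by
      intro h0
      have := (hΦfr _ _ hyT hyσ).2 h0
      rw [hσ'Φ] at this
      exact this.2 hy
    rcases lt_or_gt_of_ne hy0 with h0 | h0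
    · exact disjoint_left.1 hneg ⟨_, ⟨by simpa using hyT, (abs_lt.1 hyσ).1, h0⟩, hσ'Φ y⟩
        (interior_subset hy)
    · exact disjoint_left.1 h ⟨_, ⟨by simpa using hyT, h0, (abs_lt.1 hyσ).2⟩, hσ'Φ y⟩
        (interior_subset hy)
  filter_upwards [hnhds] with y ⟨hyT, hyσ⟩
  have hfr' := hΦfr _ _ hyT hyσ
  rw [hσ'Φ] at hfr'
  have hσe : ⟪y - x₀, ν⟫ + f (T (y - x₀)) = -σ' y := by simp only [σ']; ring
  rw [hσe]
  refine ⟨⟨fun hy => ?_, fun hy => ?_⟩, fun hy => by rw [hfr'.1 hy, neg_zero]⟩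
  · by_contra! h0
    exact disjoint_left.1 hneg ⟨_, ⟨by simpa using hyT, (abs_lt.1 hyσ).1, by linarith⟩, hσ'Φ y⟩ hy
  · rcases (neg_nonpos.1 hy).eq_or_lt with h0 | h0
    · exact hcl.frontier_subset (hfr'.2 h0.symm)
    · exact hpos ⟨_, ⟨by simpa using hyT, h0, (abs_lt.1 hyσ).2⟩, hσ'Φ y⟩

end Charts

lemma eventually_taylor_two {E : Type*} [NormedAddCommGroup E] [NormedSpace ℝ E] {f : E → ℝ}
    (hf : ContDiffAt ℝ 2 f 0) {η : ℝ} (hη : 0 < η) :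
    ∀ᶠ p : E × E in 𝓝 (0, 0), |f p.2 - f p.1 - fderiv ℝ f p.1 (p.2 - p.1)
      - 1 / 2 * fderiv ℝ (fderiv ℝ f) 0 (p.2 - p.1) (p.2 - p.1)| ≤ η * ‖p.2 - p.1‖ ^ 2 := by
  set Q := fderiv ℝ (fderiv ℝ f) 0
  have hg : HasStrictFDerivAt (fderiv ℝ f) Q 0 :=
    (hf.fderiv_right (m := 1) (by norm_num)).hasStrictFDerivAt one_ne_zero
  have h1 := hg.isLittleO.def hη
  have h2 : ∀ᶠ v in 𝓝 (0 : E), ContDiffAt ℝ 2 f v := hf.eventually (by simp)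
  obtain ⟨r, hr, h1r⟩ := Metric.eventually_nhds_iff_ball.1 h1
  obtain ⟨s, hs, h2s⟩ := Metric.eventually_nhds_iff_ball.1 h2
  filter_upwards [ball_mem_nhds ((0, 0) : E × E) (lt_min hr hs)] with p hp
  obtain ⟨v, v'⟩ := p
  rw [mem_ball, Prod.dist_eq, dist_zero_right, dist_zero_right, max_lt_iff] at hp
  have hseg : ∀ t ∈ Icc (0 : ℝ) 1, v + t • (v' - v) ∈ ball (0 : E) (min r s) := fun t ht =>
    (convex_ball (0 : E) _).add_smul_sub_mem (by simpa using hp.1) (by simpa using hp.2) ht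
  set w := v' - v
  have hmv := norm_image_sub_le_of_norm_deriv_le_segment_01'
    (f := fun t : ℝ => f (v + t • w) - t * fderiv ℝ f v w - t ^ 2 / 2 * Q w w)
    (f' := fun t => (fderiv ℝ f (v + t • w) - fderiv ℝ f v - Q (t • w)) w) (C := η * ‖w‖ ^ 2)
    (fun t ht => by
      refine HasDerivAt.hasDerivWithinAt ?_
      have hd : HasFDerivAt f (fderiv ℝ f (v + t • w)) (v + t • w) :=
        ((h2s _ (ball_subset_ball (min_le_right _ _) (hseg t ht))).differentiableAt
          (by norm_num)).hasFDerivAt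
      have hl : HasDerivAt (fun t : ℝ => v + t • w) w t := by
        simpa using ((hasDerivAt_id t).smul_const w).const_add v
      have h3 : HasDerivAt (fun t : ℝ => t ^ 2 / 2 * Q w w) (t * Q w w) t := by
        have := ((hasDerivAt_pow 2 t).div_const 2).mul_const (Q w w)
        exact this.congr_deriv (by norm_num)
      have h4 : HasDerivAt (fun t : ℝ => t * fderiv ℝ f v w) (fderiv ℝ f v w) t := by
        simpa using (hasDerivAt_id t).mul_const (fderiv ℝ f v w)
      exact (((hd.comp_hasDerivAt t hl).sub h4).sub h3).congr_deriv (by simp))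
    (fun t ht => by
      have ht' : t ∈ Icc (0 : ℝ) 1 := ⟨ht.1, ht.2.le⟩
      have hb : (v + t • w, v) ∈ ball ((0, 0) : E × E) r := by
        rw [mem_ball, Prod.dist_eq, dist_zero_right, dist_zero_right, max_lt_iff]
        exact ⟨by simpa using (ball_subset_ball (min_le_left _ _) (hseg t ht')),
          hp.1.trans_le (min_le_left _ _)⟩
      have := h1r _ hb
      simp only [add_sub_cancel_left, norm_smul, Real.norm_eq_abs, abs_of_nonneg ht.1] at this
      calc _ ≤ ‖fderiv ℝ f (v + t • w) - fderiv ℝ f v - Q (t • w)‖ * ‖w‖ :=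
            ContinuousLinearMap.le_opNorm _ _
        _ ≤ (η * (t * ‖w‖)) * ‖w‖ := by gcongr
        _ = t * (η * ‖w‖ ^ 2) := by ring
        _ ≤ 1 * (η * ‖w‖ ^ 2) := by gcongr; exact ht.2.le
        _ = _ := one_mul _)
  rw [Real.norm_eq_abs] at hmv
  convert hmv using 2
  simp [w]
  ring

lemma second_fderiv_nonneg {E : Type*} [NormedAddCommGroup E] [NormedSpace ℝ E] {f : E → ℝ}
    (hf : ContDiffAt ℝ 2 f 0) (hf0 : f 0 = 0) (hdf : fderiv ℝ f 0 = 0)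
    (hpos : ∀ᶠ v in 𝓝 0, 0 ≤ f v) (v : E) : 0 ≤ fderiv ℝ (fderiv ℝ f) 0 v v := by
  by_contra! hneg
  set q := fderiv ℝ (fderiv ℝ f) 0 v v with hq
  have hη : 0 < -q / (4 * (‖v‖ ^ 2 + 1)) := by
    have : 0 < -q := by linarith
    positivity
  have ht : Tendsto (fun t : ℝ => ((0, t • v) : E × E)) (𝓝 0) (𝓝 (0, 0)) := by
    have : Continuous (fun t : ℝ => ((0, t • v) : E × E)) := by fun_prop
    simpa using this.tendsto 0
  have ht' : Tendsto (fun t : ℝ => t • v) (𝓝 0) (𝓝 0) := by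
    have : Continuous (fun t : ℝ => t • v) := by fun_prop
    simpa using this.tendsto 0
  have hpos0 : ∀ᶠ t : ℝ in 𝓝[>] 0, 0 < t := self_mem_nhdsWithin
  obtain ⟨t, ⟨h1, h2⟩, ht0⟩ := ((((ht.eventually (eventually_taylor_two hf hη)).and
    (ht'.eventually hpos)).filter_mono nhdsWithin_le_nhds).and hpos0).exists
  simp only [hf0, hdf, sub_zero, zero_apply, map_smul,
    smul_apply, smul_eq_mul, norm_smul, mul_pow, ← hq] at h1
  have h3 := (abs_le.1 h1).2
  have h4 : -q / (4 * (‖v‖ ^ 2 + 1)) * ‖v‖ ^ 2 ≤ -q / 4 := by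
    rw [div_mul_eq_mul_div, div_le_div_iff₀ (by positivity) (by norm_num)]
    nlinarith [sq_nonneg ‖v‖]
  rw [Real.norm_eq_abs, sq_abs] at h3
  have h5 : f (t • v) ≤ t ^ 2 * (q / 4) := by nlinarith [sq_nonneg t]
  nlinarith [pow_pos ht0 2]

open scoped MatrixOrder in
lemma exists_linear_factor {m : ℕ} (Q : Euc m →L[ℝ] Euc m →L[ℝ] ℝ) (hsymm : ∀ v w, Q v w = Q w v)
    (hQ : ∀ v, 0 ≤ Q v v) :
    ∃ B : Euc m →ₗ[ℝ] Euc m, (∀ v, Q v v = ‖B v‖ ^ 2) ∧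
      LinearMap.det B ^ 2 = (Matrix.of fun i j : Fin m =>
        Q (EuclideanSpace.single i 1) (EuclideanSpace.single j 1)).det := by
  set H : Matrix (Fin m) (Fin m) ℝ := Matrix.of fun i j : Fin m =>
        Q (EuclideanSpace.single i 1) (EuclideanSpace.single j 1) with hH
  have hQH : ∀ v : Euc m, Q v v = v.ofLp ⬝ᵥ (H.mulVec v.ofLp) := by
    intro v
    have hv : v = ∑ i, v i • EuclideanSpace.single i (1 : ℝ) := by
      simpa using ((EuclideanSpace.basisFun (Fin m) ℝ).sum_repr v).symm
    conv_lhs => rw [hv]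
    simp only [map_sum, map_smul, sum_apply, smul_apply,
      smul_eq_mul, dotProduct, Matrix.mulVec, hH, Matrix.of_apply, Finset.mul_sum]
    rw [Finset.sum_comm]
    refine Finset.sum_congr rfl fun i _ => Finset.sum_congr rfl fun j _ => ?_
    ring
  have hps : H.PosSemidef := by
    refine Matrix.PosSemidef.of_dotProduct_mulVec_nonneg ?_ fun v => ?_
    · ext i j
      simpa [hH] using hsymm _ _
    · have := hQ (WithLp.toLp 2 v)
      rw [hQH] at this
      simpa using this
  obtain ⟨B, hB⟩ := CStarAlgebra.nonneg_iff_eq_star_mul_self.mp hps.nonneg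
  refine ⟨B.toLpLin 2 2, fun v => ?_, ?_⟩
  · rw [hQH, hB, EuclideanSpace.real_norm_sq_eq, Matrix.ofLp_toLpLin, ← Matrix.mulVec_mulVec,
      Matrix.dotProduct_mulVec, Matrix.star_eq_conjTranspose, Matrix.vecMul_conjTranspose]
    simp [dotProduct, sq]
  · rw [LinearMap.det_toLpLin, hB, Matrix.det_mul, Matrix.star_eq_conjTranspose,
      Matrix.det_conjTranspose]
    simp [sq]

lemma det_scale_shear {m : ℕ} (B : Euc m →ₗ[ℝ] Euc m) (g : Euc m →L[ℝ] ℝ) (a b : ℝ) :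
    LinearMap.det (((a • B).prodMap (b • LinearMap.id : ℝ →ₗ[ℝ] ℝ)) ∘ₗ
      LinearMap.transvection (g.toLinearMap ∘ₗ LinearMap.fst ℝ (Euc m) ℝ) ((0, 1) : Euc m × ℝ)) =
      a ^ m * b * LinearMap.det B := by
  rw [LinearMap.det_comp, LinearMap.det_prodMap, LinearMap.transvection.det, LinearMap.det_smul,
    LinearMap.det_smul]
  simp
  ring

lemma volume_preimage_model {m n : ℕ} (hmn : m + 1 = n) {ν : Euc n} (L : Euc m →ₗᵢ[ℝ] Euc n)
    (hν : ‖ν‖ = 1) (hL : ∀ v, ⟪L v, ν⟫ = 0) {k : ℝ} (hk : 0 < k) (B : Euc m →ₗ[ℝ] Euc m)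
    (hB : LinearMap.det B ^ 2 = k) (g : Euc m →L[ℝ] ℝ) (z : Euc n) {r : ℝ} (hr : 0 < r)
    (A : Set (Euc m × ℝ)) :
    volume {y : Euc n | (r⁻¹ • B (L.toContinuousLinearMap.adjoint (y - z)),
      (⟪y - z, ν⟫ + g (L.toContinuousLinearMap.adjoint (y - z))) / r ^ 2) ∈ A} =
      ENNReal.ofReal (r ^ (m + 2) / √k) * volume A := by
  set T := L.toContinuousLinearMap.adjoint
  set D : Euc m × ℝ →ₗ[ℝ] Euc m × ℝ :=
    ((r⁻¹ • B).prodMap ((r ^ 2)⁻¹ • LinearMap.id : ℝ →ₗ[ℝ] ℝ)) ∘ₗ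
      LinearMap.transvection (g.toLinearMap ∘ₗ LinearMap.fst ℝ (Euc m) ℝ) ((0, 1) : Euc m × ℝ)
    with hD
  have hdet : LinearMap.det D = r⁻¹ ^ m * (r ^ 2)⁻¹ * LinearMap.det B := det_scale_shear _ _ _ _
  have hdB : |LinearMap.det B| = √k := by rw [← hB, Real.sqrt_sq_eq_abs]
  have hdB0 : LinearMap.det B ≠ 0 := by
    rintro h
    rw [h] at hB
    norm_num at hB
    exact hk.ne hB
  have hdet0 : LinearMap.det D ≠ 0 := by rw [hdet]; positivity
  let e := (MeasurableEquiv.toLp 2 (Euc m × ℝ)).trans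
    (splitIsometryEquiv L hν hL hmn).toMeasurableEquiv
  have he : MeasurePreserving e :=
    (splitIsometryEquiv L hν hL hmn).measurePreserving.comp
      (WithLp.volume_preserving_toLp (Euc m) ℝ)
  have hez : ∀ p : Euc m × ℝ, e p = L p.1 + p.2 • ν := fun p => rfl
  have hset : {y : Euc n | (r⁻¹ • B (T (y - z)), (⟪y - z, ν⟫ + g (T (y - z))) / r ^ 2) ∈ A} =
      (fun y => y + -z) ⁻¹' {y : Euc n | (r⁻¹ • B (T y), (⟪y, ν⟫ + g (T y)) / r ^ 2) ∈ A} := by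
    ext y; simp [sub_eq_add_neg]
  have hpre : e ⁻¹' {y : Euc n | (r⁻¹ • B (T y), (⟪y, ν⟫ + g (T y)) / r ^ 2) ∈ A} = D ⁻¹' A := by
    ext p
    have h1 : T (e p) = p.1 := by
      rw [hez, map_add, map_smul]
      simp [T, adjoint_apply_isometry, adjoint_apply_normal L hL]
    have h2 : ⟪e p, ν⟫ = p.2 := by
      rw [hez, inner_add_left, hL, real_inner_smul_left, real_inner_self_eq_norm_sq, hν]
      simp
    rw [mem_preimage, mem_preimage, mem_ofPred_eq, h1, h2]
    have h3 : D p = (r⁻¹ • B p.1, (p.2 + g p.1) / r ^ 2) := by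
      simp [hD, LinearMap.transvection, div_eq_inv_mul]
    rw [h3]
  have : (volume : Measure (Euc m × ℝ)).IsAddHaarMeasure :=
    Measure.prod.instIsAddHaarMeasure volume volume
  rw [hset, measure_preimage_add_right, ← he.measure_preimage_equiv, hpre,
    Measure.addHaar_preimage_linearMap _ hdet0, hdet]
  congr 2
  rw [abs_inv, abs_mul, hdB, abs_of_pos (by positivity)]
  rw [pow_add, inv_pow]
  field_simp

lemma isLocalModel_of_graph {m n : ℕ} (hmn : m + 1 = n) {S : Set (Euc n)} {x₀ ν : Euc n}
    (L : Euc m →ₗᵢ[ℝ] Euc n) (hν : ‖ν‖ = 1) (hL : ∀ v, ⟪L v, ν⟫ = 0) {f : Euc m → ℝ}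
    (hf : ContDiffAt ℝ 2 f 0) (hdf : fderiv ℝ f 0 = 0)
    (hgraph : ∀ᶠ y in 𝓝 x₀,
      (y ∈ S ↔ ⟪y - x₀, ν⟫ + f (L.toContinuousLinearMap.adjoint (y - x₀)) ≤ 0) ∧
      (y ∈ frontier S → ⟪y - x₀, ν⟫ + f (L.toContinuousLinearMap.adjoint (y - x₀)) = 0))
    {k : ℝ} (hk : 0 < k) (B : Euc m →ₗ[ℝ] Euc m) (hBk : LinearMap.det B ^ 2 = k)
    (hB : ∀ v, fderiv ℝ (fderiv ℝ f) 0 v v = ‖B v‖ ^ 2) :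
    IsLocalModel S x₀ ν k (B.toContinuousLinearMap ∘L L.toContinuousLinearMap.adjoint)
      (fun x => innerSL ℝ ν + fderiv ℝ f (L.toContinuousLinearMap.adjoint (x - x₀)) ∘L
        L.toContinuousLinearMap.adjoint) := by
  set T := L.toContinuousLinearMap.adjoint with hT
  have hTL : ∀ v, T (L v) = v := adjoint_apply_isometry L
  have hTν : T ν = 0 := adjoint_apply_normal L hL
  have hdec : ∀ y, L (T y) + ⟪y, ν⟫ • ν = y := adjoint_decomposition L hν hL hmn
  have hνν : ⟪ν, ν⟫ = 1 := by rw [real_inner_self_eq_norm_sq, hν]; norm_num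
  have hdet0 : IsUnit (LinearMap.det B) := by
    rw [isUnit_iff_ne_zero]
    intro h
    rw [h] at hBk
    norm_num at hBk
    exact hk.ne hBk
  let Be := LinearEquiv.ofIsUnitDet (f := B) (v := Module.finBasis ℝ (Euc m))
    (v' := Module.finBasis ℝ (Euc m)) (by rwa [LinearMap.det_toMatrix])
  have hBe : ∀ v, Be v = B v := fun v => rfl
  obtain ⟨c, hc, hcB⟩ : ∃ c > 0, ∀ v, ‖v‖ ≤ c * ‖B v‖ := by
    refine ⟨‖(Be.symm : Euc m →ₗ[ℝ] Euc m).toContinuousLinearMap‖ + 1, by positivity, fun v => ?_⟩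
    have := (Be.symm : Euc m →ₗ[ℝ] Euc m).toContinuousLinearMap.le_opNorm (B v)
    simp only [LinearMap.coe_toContinuousLinearMap', LinearEquiv.coe_coe, ← hBe,
      LinearEquiv.symm_apply_apply] at this ⊢
    refine this.trans ?_
    gcongr
    linarith
  have hgc : ContinuousAt (fun x => fderiv ℝ f (T (x - x₀))) x₀ := by
    have h1 : ContinuousAt (fderiv ℝ f) (T (x₀ - x₀)) := by
      rw [sub_self, map_zero]
      exact (hf.fderiv_right (m := 1) (by norm_num)).continuousAt
    exact ContinuousAt.comp (f := fun x => T (x - x₀)) h1 (by fun_prop)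
  constructor
  · exact continuousAt_const.add (hgc.clm_comp continuousAt_const)
  · intro y
    simp [hdf, real_inner_comm]
  · intro x w s
    refine ⟨L (Be.symm w) + (s - fderiv ℝ f (T (x - x₀)) (Be.symm w)) • ν, ?_, ?_⟩
    · simp only [ContinuousLinearMap.comp_apply, map_add, map_smul, hTL, hTν, map_zero,
        smul_zero, add_zero]
      exact Be.apply_symm_apply w
    · simp only [add_apply, ContinuousLinearMap.comp_apply, map_add, map_smul,
        hTL, hTν, innerSL_apply_apply, hνν, real_inner_comm _ ν, hL]
      simp
  · refine ⟨2 * c + 1, by positivity, ?_⟩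
    have h0 : ‖fderiv ℝ f (T (x₀ - x₀))‖ < 1 := by simp [hdf]
    filter_upwards [hgc.norm.eventually_lt_const h0] with x hx y
    have h1 : ‖y‖ ≤ ‖T y‖ + |⟪y, ν⟫| := by
      conv_lhs => rw [← hdec y]
      refine (norm_add_le _ _).trans ?_
      rw [L.norm_map, norm_smul, hν, mul_one, Real.norm_eq_abs]
    have h2 : ‖T y‖ ≤ c * ‖B (T y)‖ := hcB _
    have h3 : |fderiv ℝ f (T (x - x₀)) (T y)| ≤ ‖T y‖ :=
      (ContinuousLinearMap.le_opNorm _ _).trans (mul_le_of_le_one_left (norm_nonneg _) hx.le)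
    have h4 : |⟪y, ν⟫| ≤ |⟪y, ν⟫ + fderiv ℝ f (T (x - x₀)) (T y)|
        + |fderiv ℝ f (T (x - x₀)) (T y)| := by
      have := abs_sub (⟪y, ν⟫ + fderiv ℝ f (T (x - x₀)) (T y)) (fderiv ℝ f (T (x - x₀)) (T y))
      rwa [add_sub_cancel_right] at this
    have e5 : ⟪ν, y⟫ = ⟪y, ν⟫ := real_inner_comm _ _
    simp only [ContinuousLinearMap.comp_apply, add_apply, innerSL_apply_apply,
      LinearMap.coe_toContinuousLinearMap', e5]
    have h5 : 0 ≤ c * |⟪y, ν⟫ + fderiv ℝ f (T (x - x₀)) (T y)| := by positivity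
    nlinarith [norm_nonneg (B (T y))]
  · intro x z r hr A
    have := volume_preimage_model hmn L hν hL hk B hBk (fderiv ℝ f (T (x - x₀))) z hr A
    simp only [ContinuousLinearMap.comp_apply, add_apply, innerSL_apply_apply,
      LinearMap.coe_toContinuousLinearMap']
    simpa only [real_inner_comm] using this
  · intro η hη
    have hη' : 0 < η / (2 * c ^ 2) := by positivity
    have ht : Tendsto (fun p : Euc n × Euc n => (T (p.1 - x₀), T (p.2 - x₀))) (𝓝 (x₀, x₀))
        (𝓝 (0, 0)) := by
      have : Continuous (fun p : Euc n × Euc n => (T (p.1 - x₀), T (p.2 - x₀))) := by fun_prop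
      simpa using this.tendsto (x₀, x₀)
    have hg1 := (continuous_fst.tendsto ((x₀, x₀) : Euc n × Euc n)).eventually hgraph
    have hg2 := (continuous_snd.tendsto ((x₀, x₀) : Euc n × Euc n)).eventually hgraph
    filter_upwards [hg1, hg2, ht.eventually (eventually_taylor_two hf hη')] with p h1 h2 h3 hp
    obtain ⟨x, y⟩ := p
    simp only at h1 h2 h3 hp ⊢
    have e1 := h1.2 hp
    have e2 : T (y - x₀) - T (x - x₀) = T (y - x) := by rw [← map_sub]; congr 1; abel
    have e3 : ⟪y - x₀, ν⟫ = ⟪y - x, ν⟫ + ⟪x - x₀, ν⟫ := by rw [← inner_add_left]; congr 1; abel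
    rw [e2, hB] at h3
    have e4 : η / (2 * c ^ 2) * ‖T (y - x)‖ ^ 2 ≤ η / 2 * ‖B (T (y - x))‖ ^ 2 := by
      have h5 : ‖T (y - x)‖ ^ 2 ≤ (c * ‖B (T (y - x))‖) ^ 2 := by gcongr; exact hcB _
      calc _ ≤ η / (2 * c ^ 2) * (c * ‖B (T (y - x))‖) ^ 2 := by gcongr
        _ = _ := by field_simp
    rw [h2.1, e3]
    obtain ⟨h6, h7⟩ := abs_le.1 (h3.trans e4)
    have e5 : ⟪ν, y - x⟫ = ⟪y - x, ν⟫ := real_inner_comm _ _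
    simp only [ContinuousLinearMap.comp_apply, add_apply, innerSL_apply_apply,
      LinearMap.coe_toContinuousLinearMap', e5]
    constructor <;> intro h <;> linarith

lemma exists_isLocalModel {n : ℕ} (hn : 2 ≤ n) {S : Set (Euc n)} (hcl : IsClosed S)
    (hc : Convex ℝ S) (hne : (interior S).Nonempty) {x₀ ν : Euc n} {k : ℝ}
    (hx₀ : x₀ ∈ frontier S) (hν : IsOuterNormalAt S x₀ ν) (hk : 0 < k)
    (hcurv : IsGaussCurvatureAt S x₀ ν k) :
    ∃ (W : Euc n →L[ℝ] Euc (n - 1)) (ℓ : Euc n → Euc n →L[ℝ] ℝ), IsLocalModel S x₀ ν k W ℓ := by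
  obtain ⟨L, f, τ, ε, hτ, hε, hL, hf, hf0, hdf, hfr, rfl⟩ := hcurv
  have hmn : n - 1 + 1 = n := by omega
  have hf2 : ContDiffAt ℝ 2 f 0 := hf.contDiffAt (ball_mem_nhds _ hτ)
  have hpos : ∀ᶠ v in 𝓝 (0 : Euc (n - 1)), 0 ≤ f v := by
    have hcont : ContinuousAt (fun v => x₀ + L v - f v • ν) 0 :=
      ContinuousAt.sub (by fun_prop) (hf2.continuousAt.smul continuousAt_const)
    have hb : ∀ᶠ v in 𝓝 (0 : Euc (n - 1)), x₀ + L v - f v • ν ∈ ball x₀ ε :=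
      hcont.eventually_mem (by simpa [hf0] using ball_mem_nhds x₀ hε)
    filter_upwards [hb, ball_mem_nhds (0 : Euc (n - 1)) hτ] with v h1 h2
    have hmem : x₀ + L v - f v • ν ∈ frontier S ∩ ball x₀ ε := by
      rw [hfr]; exact ⟨⟨v, h2, rfl⟩, h1⟩
    have := hν.2 _ (hcl.frontier_subset hmem.1)
    rw [inner_sub_left, inner_add_left, hL, real_inner_smul_left, real_inner_self_eq_norm_sq,
      hν.1] at this
    linarith
  have hsymm : ∀ v w, fderiv ℝ (fderiv ℝ f) 0 v w = fderiv ℝ (fderiv ℝ f) 0 w v :=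
    fun v w => (hf2.isSymmSndFDerivAt (by simp)).eq v w
  obtain ⟨B, hB, hdet⟩ := exists_linear_factor _ hsymm (second_fderiv_nonneg hf2 hf0 hdf hpos)
  exact ⟨_, _, isLocalModel_of_graph hmn L hν.1 hL hf2 hdf
    (eventually_mem_iff_graph L hν.1 hL hmn hcl hc hne hx₀ hν.2 hτ hε hf.continuousOn hf0 hfr)
    hk B (by simpa [iteratedFDeriv_two_apply] using hdet) hB⟩

lemma eventually_forall_of_isCompact {X Y : Type*} [TopologicalSpace X] {K : Set X}
    (hK : IsCompact K) {l : Filter Y} {P : X → Y → Prop}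
    (h : ∀ x ∈ K, ∀ᶠ p in 𝓝[K] x ×ˢ l, P p.1 p.2) : ∀ᶠ y in l, ∀ x ∈ K, P x y := by
  refine hK.induction_on (p := fun s => ∀ᶠ y in l, ∀ x ∈ s, P x y) (by simp)
    (fun s t hst ht => ht.mono fun y hy x hx => hy x (hst hx))
    (fun s t hs ht => (hs.and ht).mono fun y hy x hx => hx.elim (hy.1 x) (hy.2 x)) fun x hx => ?_
  obtain ⟨p, hp, q, hq, hpq⟩ := eventually_prod_iff.1 (h x hx)
  exact ⟨{z | p z}, hp, hq.mono fun y hy z hz => hpq hz hy⟩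

lemma exists_tendsto_zero_of_eventually {P : ℝ → ℝ → Prop}
    (h : ∀ η ∈ Ioo (0 : ℝ) 1, ∀ᶠ δ in 𝓝[>] 0, P η δ) :
    ∃ Ψ : ℝ → ℝ, (∀ δ, 0 ≤ Ψ δ) ∧ Tendsto Ψ (𝓝[>] 0) (𝓝 0) ∧ ∀ᶠ δ in 𝓝[>] 0, P (Ψ δ) δ := by
  have hchoice : ∀ δ : ℝ, ∃ ψ, 0 ≤ ψ ∧ ∀ η ∈ Ioo (0 : ℝ) 1, 0 < δ → P η δ → ψ < η + δ ∧ P ψ δ := by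
    intro δ
    by_cases hne : 0 < δ ∧ ({η | η ∈ Ioo (0 : ℝ) 1 ∧ P η δ} : Set ℝ).Nonempty
    · obtain ⟨ψ, hψ, hlt⟩ := Real.lt_sInf_add_pos hne.2 hne.1
      refine ⟨ψ, hψ.1.1.le, fun η hη _ hP => ⟨hlt.trans_le ?_, hψ.2⟩⟩
      gcongr
      exact csInf_le ⟨0, fun z hz => hz.1.1.le⟩ ⟨hη, hP⟩
    · exact ⟨0, le_rfl, fun η hη hδ hP => (hne ⟨hδ, η, hη, hP⟩).elim⟩
  choose Ψ hΨ0 hΨ using hchoice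
  refine ⟨Ψ, hΨ0, ?_, ?_⟩
  · refine Metric.tendsto_nhds.2 fun ε hε => ?_
    have hm : min (ε / 2) (1 / 2) ∈ Ioo (0 : ℝ) 1 :=
      ⟨by positivity, (min_le_right _ _).trans_lt (by norm_num)⟩
    filter_upwards [h _ hm, Ioo_mem_nhdsGT (half_pos hε)] with δ hP hδ
    rw [dist_zero_right, Real.norm_eq_abs, abs_of_nonneg (hΨ0 δ)]
    have := (hΨ δ _ hm hδ.1 hP).1
    linarith [hδ.2, min_le_left (ε / 2) (1 / 2)]
  · filter_upwards [h (1 / 2) ⟨by norm_num, by norm_num⟩, self_mem_nhdsWithin] with δ hP hδ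
    exact (hΨ δ _ ⟨by norm_num, by norm_num⟩ hδ hP).2

section Bodies

variable {n : ℕ} {S : Set (Euc n)}

lemma IsSymConvexBody.zero_mem_interior (hS : IsSymConvexBody S) : (0 : Euc n) ∈ interior S := by
  obtain ⟨-, hc, ⟨x, hx⟩, hsymm⟩ := hS
  have hx' : -x ∈ interior S := by
    have h := (Homeomorph.neg (Euc n)).preimage_interior S
    rw [show Homeomorph.neg (Euc n) ⁻¹' S = S from hsymm.symm] at h
    rw [← h] at hx
    exact hx
  have := hc.interior hx hx' (by norm_num : (0 : ℝ) ≤ 1 / 2) (by norm_num : (0 : ℝ) ≤ 1 / 2)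
    (by norm_num)
  simpa using this

lemma inner_outerNormal_pos (h0 : (0 : Euc n) ∈ interior S) {x ν : Euc n}
    (hν : IsOuterNormalAt S x ν) : 0 < ⟪x, ν⟫ := by
  have hc : ContinuousAt (fun t : ℝ => t • ν) 0 := by fun_prop
  have hmem : ∀ᶠ t : ℝ in 𝓝 0, t • ν ∈ interior S :=
    hc.eventually_mem (by simpa using isOpen_interior.mem_nhds h0)
  have hpos : ∀ᶠ t : ℝ in 𝓝[>] 0, 0 < t := self_mem_nhdsWithin
  obtain ⟨t, ht, ht0⟩ := ((hmem.filter_mono nhdsWithin_le_nhds).and hpos).exists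
  have := hν.2 _ (interior_subset ht)
  rw [real_inner_smul_left, real_inner_self_eq_norm_sq, hν.1] at this
  linarith

/-- The limit of `r ^ (-(n + 1))` times the volume added to `S` by the point `(1 + r ^ 2) • x`. -/
def bodyCapLimit (u : Euc n → Euc n) (κ : Euc n → ℝ) (x : Euc n) : ℝ :=
  capLimit (n - 1) ⟪x, u x⟫ (κ x)

lemma midpoint_mem_interior (hn : 2 ≤ n) {u : Euc n → Euc n} {κ : Euc n → ℝ}
    (hS : IsSymConvexBody S) (hC2 : IsC2Body S u κ) (hκ : ∀ x ∈ frontier S, 0 < κ x)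
    {p q : Euc n} (hp : p ∈ S) (hq : q ∈ S) (hpq : p ≠ q) :
    (1 / 2 : ℝ) • (p + q) ∈ interior S := by
  have hmid : (1 / 2 : ℝ) • (p + q) ∈ S := by
    rw [smul_add]
    exact hS.2.1 hp hq (by norm_num) (by norm_num) (by norm_num)
  by_contra hni
  have hfr : (1 / 2 : ℝ) • (p + q) ∈ frontier S := ⟨subset_closure hmid, hni⟩
  obtain ⟨W, ℓ, M⟩ := exists_isLocalModel hn hS.1.isClosed hS.2.1 hS.2.2.1 hfr (hC2 _ hfr).1
    (hκ _ hfr) (hC2 _ hfr).2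
  have h1 : (1 / 2 : ℝ) • (p + q) + (1 / 2 : ℝ) • (p - q) = p := by module
  have h2 : (1 / 2 : ℝ) • (p + q) - (1 / 2 : ℝ) • (p - q) = q := by module
  have := M.eq_zero_of_mem hS.2.1 hfr hmid (by rwa [h1]) (by rwa [h2])
  exact hpq (sub_eq_zero.1 ((smul_eq_zero.1 this).resolve_left (by norm_num)))

lemma eventually_volume_lt (hn : 2 ≤ n) {u : Euc n → Euc n} {κ : Euc n → ℝ}
    (hS : IsSymConvexBody S) (hC2 : IsC2Body S u κ) (hκ : ∀ x ∈ frontier S, 0 < κ x)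
    {x₀ : Euc n} (hx₀ : x₀ ∈ frontier S) {B : ℝ} (hB : bodyCapLimit u κ x₀ < B) :
    ∀ᶠ x : Euc n × ℝ in 𝓝[frontier S] x₀ ×ˢ 𝓝[>] 0,
      volume (convexHull ℝ (S ∪ {(1 + x.2 ^ 2) • x.1}) \ S) < ENNReal.ofReal (B * x.2 ^ (n + 1)) := by
  obtain ⟨W, ℓ, M⟩ := exists_isLocalModel hn hS.1.isClosed hS.2.1 hS.2.2.1 hx₀ (hC2 _ hx₀).1
    (hκ _ hx₀) (hC2 _ hx₀).2
  have := M.eventually_volume_lt (by omega) hS.1 hS.2.1 hx₀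
    (inner_outerNormal_pos hS.zero_mem_interior (hC2 _ hx₀).1)
    (fun p hp hpx => midpoint_mem_interior hn hS hC2 hκ hp (hS.1.isClosed.frontier_subset hx₀) hpx)
    hB
  rwa [show n - 1 + 2 = n + 1 by omega] at this

lemma eventually_lt_volume (hn : 2 ≤ n) {u : Euc n → Euc n} {κ : Euc n → ℝ}
    (hS : IsSymConvexBody S) (hC2 : IsC2Body S u κ) (hκ : ∀ x ∈ frontier S, 0 < κ x)
    {x₀ : Euc n} (hx₀ : x₀ ∈ frontier S) {B : ℝ} (hB0 : 0 ≤ B) (hB : B < bodyCapLimit u κ x₀) :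
    ∀ᶠ x : Euc n × ℝ in 𝓝[frontier S] x₀ ×ˢ 𝓝[>] 0,
      ENNReal.ofReal (B * x.2 ^ (n + 1)) < volume (convexHull ℝ (S ∪ {(1 + x.2 ^ 2) • x.1}) \ S) := by
  obtain ⟨W, ℓ, M⟩ := exists_isLocalModel hn hS.1.isClosed hS.2.1 hS.2.2.1 hx₀ (hC2 _ hx₀).1
    (hκ _ hx₀) (hC2 _ hx₀).2
  have := M.eventually_lt_volume (by omega)
    (inner_outerNormal_pos hS.zero_mem_interior (hC2 _ hx₀).1) hB0 hB
  rwa [show n - 1 + 2 = n + 1 by omega] at this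

lemma bodyCapLimit_pos (hS : IsSymConvexBody S) {u : Euc n → Euc n} {κ : Euc n → ℝ}
    (hC2 : IsC2Body S u κ) (hκ : ∀ x ∈ frontier S, 0 < κ x) {x : Euc n} (hx : x ∈ frontier S) :
    0 < bodyCapLimit u κ x := by
  have h1 := inner_outerNormal_pos hS.zero_mem_interior (hC2 _ hx).1
  have h2 := hκ x hx
  have h3 : 0 < (volume (ball (0 : Euc (n - 1)) 1)).toReal :=
    ENNReal.toReal_pos (measure_ball_pos _ _ one_pos).ne' measure_ball_lt_top.ne
  unfold bodyCapLimit capLimit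
  positivity

lemma exists_pos_le_bodyCapLimit (hn : 2 ≤ n) {u : Euc n → Euc n} {κ : Euc n → ℝ}
    (hS : IsSymConvexBody S) (hC2 : IsC2Body S u κ) (hκ : ∀ x ∈ frontier S, 0 < κ x) :
    ∃ b > 0, ∀ x ∈ frontier S, b ≤ bodyCapLimit u κ x := by
  have hK : IsCompact (frontier S) :=
    hS.1.of_isClosed_subset isClosed_frontier hS.1.isClosed.frontier_subset
  have key : ∀ᶠ b : ℝ in 𝓝[>] 0, ∀ x ∈ frontier S, b ≤ bodyCapLimit u κ x := by
    refine eventually_forall_of_isCompact hK fun x₀ hx₀ => ?_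
    have hpos := bodyCapLimit_pos hS hC2 hκ hx₀
    set b := bodyCapLimit u κ x₀ / 2 with hb
    have hlow := eventually_lt_volume hn hS hC2 hκ hx₀ (half_pos hpos).le (half_lt_self hpos)
    obtain ⟨p, hp, q, hq, hpq⟩ := eventually_prod_iff.1 hlow
    refine eventually_prod_iff.2 ⟨fun x => p x ∧ x ∈ frontier S,
      hp.and self_mem_nhdsWithin, fun c => c ≤ b, ?_, fun {x} hx {c} hc => hc.trans ?_⟩
    · exact (eventually_le_nhds (half_pos hpos)).filter_mono nhdsWithin_le_nhds
    · by_contra! hlt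
      have hup := eventually_volume_lt hn hS hC2 hκ hx.2 hlt
      have hxup : ∀ᶠ r : ℝ in 𝓝[>] 0, volume (convexHull ℝ (S ∪ {(1 + r ^ 2) • x}) \ S)
          < ENNReal.ofReal (b * r ^ (n + 1)) := by
        obtain ⟨p', hp', q', hq', hpq'⟩ := eventually_prod_iff.1 hup
        exact hq'.mono fun r hr => hpq' (hp'.self_of_nhdsWithin hx.2) hr
      obtain ⟨r, hr1, hr2⟩ := (hxup.and hq).exists
      exact lt_asymm hr1 (hpq hx.1 hr2)
  obtain ⟨b, hb, hpos⟩ := (key.and self_mem_nhdsWithin).exists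
  exact ⟨b, hpos, hb⟩

lemma IsSymConvexBody.volume_toReal_pos (hS : IsSymConvexBody S) : 0 < (volume S).toReal :=
  ENNReal.toReal_pos (Measure.measure_pos_of_nonempty_interior _ hS.2.2.1).ne' hS.1.measure_lt_top.ne

lemma IsSymConvexBody.mem_illuminationBody_iff (hS : IsSymConvexBody S) {δ : ℝ} (hδ : 0 ≤ δ)
    {y : Euc n} : y ∈ illuminationBody S δ ↔
      volume (convexHull ℝ (S ∪ {y}) \ S) ≤ ENNReal.ofReal ((volume S).toReal * δ) := by
  have hsub : S ⊆ convexHull ℝ (S ∪ {y}) := subset_union_left.trans (subset_convexHull ℝ _)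
  have hfin : volume S ≠ ⊤ := hS.1.measure_lt_top.ne
  have h1 := measure_inter_add_sdiff (μ := volume) (convexHull ℝ (S ∪ {y})) hS.1.measurableSet
  rw [inter_eq_right.2 hsub] at h1
  have h2 : ENNReal.ofReal (1 + δ) * volume S
      = volume S + ENNReal.ofReal ((volume S).toReal * δ) := by
    rw [ENNReal.ofReal_add zero_le_one hδ, add_mul, ENNReal.ofReal_one, one_mul,
      ENNReal.ofReal_mul ENNReal.toReal_nonneg, ENNReal.ofReal_toReal hfin, mul_comm (volume S)]
  rw [illuminationBody, mem_ofPred_eq, h2, ← h1]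
  exact ENNReal.add_le_add_iff_left hfin

lemma convexHull_union_smul_subset (h0 : (0 : Euc n) ∈ S) {t : ℝ} (ht0 : 0 ≤ t) (ht1 : t ≤ 1)
    (y : Euc n) : convexHull ℝ (S ∪ {t • y}) ⊆ convexHull ℝ (S ∪ {y}) := by
  refine convexHull_min (union_subset (subset_union_left.trans (subset_convexHull ℝ _)) ?_)
    (convex_convexHull ℝ _)
  rintro _ rfl
  exact (convex_convexHull ℝ (S ∪ {y})).smul_mem_of_zero_mem (subset_convexHull ℝ _ (Or.inl h0))
    (subset_convexHull ℝ _ (Or.inr rfl)) ⟨ht0, ht1⟩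

lemma IsSymConvexBody.exists_eq_gauge_smul (hS : IsSymConvexBody S) {y : Euc n} (hy : y ≠ 0) :
    0 < gauge S y ∧ ∃ x ∈ frontier S, y = gauge S y • x := by
  have h0 : S ∈ 𝓝 (0 : Euc n) := mem_interior_iff_mem_nhds.1 hS.zero_mem_interior
  have hpos : 0 < gauge S y := (gauge_pos (absorbent_nhds_zero h0)
    (NormedSpace.isVonNBounded_of_isBounded ℝ hS.1.isBounded)).2 hy
  refine ⟨hpos, (gauge S y)⁻¹ • y, ?_, by rw [smul_inv_smul₀ hpos.ne']⟩
  rw [← gauge_eq_one_iff_mem_frontier hS.2.1 h0, gauge_smul_of_nonneg (inv_nonneg.2 hpos.le),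
    smul_eq_mul, inv_mul_cancel₀ hpos.ne']

lemma IsSymConvexBody.frontier_nonempty (hS : IsSymConvexBody S) (hn : 2 ≤ n) :
    (frontier S).Nonempty := by
  have : Nonempty (Fin n) := ⟨⟨0, by omega⟩⟩
  obtain ⟨y, hy⟩ := exists_ne (0 : Euc n)
  obtain ⟨-, x, hx, -⟩ := hS.exists_eq_gauge_smul hy
  exact ⟨x, hx⟩

lemma IsSymConvexBody.illuminationBody_subset_smul (hS : IsSymConvexBody S) {δ c : ℝ} (hδ : 0 ≤ δ)
    (hc : 0 < c) (h : ∀ x ∈ frontier S, ENNReal.ofReal ((volume S).toReal * δ)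
      < volume (convexHull ℝ (S ∪ {c • x}) \ S)) : illuminationBody S δ ⊆ c • S := by
  intro y hy
  have h0 : (0 : Euc n) ∈ S := interior_subset hS.zero_mem_interior
  rcases eq_or_ne y 0 with rfl | hy0
  · exact ⟨0, h0, smul_zero _⟩
  obtain ⟨hs, x, hx, hyx⟩ := hS.exists_eq_gauge_smul hy0
  set s := gauge S y
  rcases le_or_gt s c with hsc | hcs
  · refine ⟨(s / c) • x, hS.2.1.smul_mem_of_zero_mem h0 (hS.1.isClosed.frontier_subset hx)
      ⟨by positivity, (div_le_one hc).2 hsc⟩, ?_⟩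
    change c • (s / c) • x = y
    rw [smul_smul, mul_div_cancel₀ _ hc.ne', hyx]
  · have hcx : c • x = (c / s) • y := by
      rw [hyx, smul_smul, div_mul_cancel₀ _ hs.ne']
    refine absurd ((hS.mem_illuminationBody_iff hδ).1 hy) (not_le.2 ((h x hx).trans_le ?_))
    rw [hcx]
    exact measure_mono (sdiff_subset_sdiff_left
      (convexHull_union_smul_subset h0 (by positivity) ((div_le_one hs).2 hcs.le) y))

lemma IsSymConvexBody.smul_subset_illuminationBody (hS : IsSymConvexBody S) {δ c : ℝ} (hδ : 0 ≤ δ)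
    (h : ∀ x ∈ frontier S, volume (convexHull ℝ (S ∪ {c • x}) \ S)
      ≤ ENNReal.ofReal ((volume S).toReal * δ)) : c • S ⊆ illuminationBody S δ := by
  rintro _ ⟨z, hz, rfl⟩
  have h0 : (0 : Euc n) ∈ S := interior_subset hS.zero_mem_interior
  change c • z ∈ _
  rw [hS.mem_illuminationBody_iff hδ]
  rcases eq_or_ne z 0 with rfl | hz0
  · rw [smul_zero, union_eq_self_of_subset_right (singleton_subset_iff.2 h0),
      hS.2.1.convexHull_eq, sdiff_self]
    simp
  obtain ⟨hs, x, hx, hzx⟩ := hS.exists_eq_gauge_smul hz0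
  refine le_trans (measure_mono (sdiff_subset_sdiff_left ?_)) (h x hx)
  rw [hzx, smul_comm]
  exact convexHull_union_smul_subset h0 hs.le (gauge_le_one_of_mem hz) _

lemma rpow_two_div_rpow {x : ℝ} (hx : 0 ≤ x) (n : ℕ) :
    (x ^ ((2 : ℝ) / (n + 1))) ^ (((n : ℝ) + 1) / 2) = x := by
  rw [← Real.rpow_mul hx, show (2 : ℝ) / (n + 1) * ((n + 1) / 2) = 1 by field_simp, Real.rpow_one]

lemma sqrt_pow_succ {x : ℝ} (hx : 0 ≤ x) (n : ℕ) : √x ^ (n + 1) = x ^ (((n : ℝ) + 1) / 2) := by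
  rw [Real.sqrt_eq_rpow, ← Real.rpow_natCast, ← Real.rpow_mul hx]
  congr 1
  push_cast
  ring

lemma sqrt_mul_rpow_pow_succ {a δ : ℝ} (ha : 0 ≤ a) (hδ : 0 ≤ δ) (n : ℕ) :
    √(a * δ ^ ((2 : ℝ) / (n + 1))) ^ (n + 1) = a ^ (((n : ℝ) + 1) / 2) * δ := by
  rw [sqrt_pow_succ (by positivity), Real.mul_rpow ha (by positivity), rpow_two_div_rpow hδ]

lemma tendsto_sqrt_mul_rpow {a : ℝ} (ha : 0 < a) (n : ℕ) :
    Tendsto (fun δ : ℝ => √(a * δ ^ ((2 : ℝ) / (n + 1)))) (𝓝[>] 0) (𝓝[>] 0) := by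
  refine tendsto_nhdsWithin_iff.2 ⟨?_, ?_⟩
  · have hp : (0 : ℝ) < 2 / (n + 1) := by positivity
    have hc : ContinuousAt (fun δ : ℝ => √(a * δ ^ ((2 : ℝ) / (n + 1)))) 0 :=
      (continuousAt_const.mul (Real.continuousAt_rpow_const _ _ (Or.inr hp.le))).sqrt
    have := hc.tendsto
    rw [Real.zero_rpow hp.ne', mul_zero, Real.sqrt_zero] at this
    exact this.mono_left nhdsWithin_le_nhds
  · filter_upwards [self_mem_nhdsWithin] with δ hδ
    have : (0 : ℝ) < δ := hδ
    exact Real.sqrt_pos.2 (by positivity)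

lemma bodyCapLimit_mul_rpow (hn : 2 ≤ n) (hS : IsSymConvexBody S) {u : Euc n → Euc n}
    {κ : Euc n → ℝ} (hC2 : IsC2Body S u κ) (hκ : ∀ x ∈ frontier S, 0 < κ x) {x : Euc n}
    (hx : x ∈ frontier S) :
    bodyCapLimit u κ x * ((n : ℝ) ^ ((2 : ℝ) / (n + 1)) * Gfun S u κ x) ^ (((n : ℝ) + 1) / 2)
      = (volume S).toReal := by
  have hh := inner_outerNormal_pos hS.zero_mem_interior (hC2 _ hx).1
  have hk := hκ x hx
  have hV := hS.volume_toReal_pos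
  have hω : 0 < (volume (ball (0 : Euc (n - 1)) 1)).toReal :=
    ENNReal.toReal_pos (measure_ball_pos _ _ one_pos).ne' measure_ball_lt_top.ne
  have hn0 : (0 : ℝ) < n := by exact_mod_cast (by omega : 0 < n)
  unfold bodyCapLimit capLimit Gfun cConst
  set h := ⟪x, u x⟫
  set k := κ x
  set V := (volume S).toReal
  set ω := (volume (ball (0 : Euc (n - 1)) 1)).toReal
  have hkr : k ^ ((1 : ℝ) / (n + 1)) = √k ^ ((2 : ℝ) / (n + 1)) := by
    rw [Real.sqrt_eq_rpow, ← Real.rpow_mul hk.le]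
    congr 1
    ring
  have hg : (n : ℝ) ^ ((2 : ℝ) / (n + 1)) * (((n + 1 : ℝ) ^ ((2 : ℝ) / (n + 1)) / 2) *
      (V / ω) ^ ((2 : ℝ) / (n + 1)) * k ^ ((1 : ℝ) / (n + 1)) / h)
      = (n * (n + 1) * (V / ω) * √k) ^ ((2 : ℝ) / (n + 1)) / (2 * h) := by
    rw [hkr, Real.mul_rpow (by positivity) (by positivity),
      Real.mul_rpow (by positivity) (by positivity), Real.mul_rpow (by positivity) (by positivity)]
    field_simp
  rw [hg, Real.div_rpow (by positivity) (by positivity), rpow_two_div_rpow (by positivity),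
    show n - 1 + 2 = n + 1 by omega, sqrt_pow_succ (by positivity),
    show ((n - 1 : ℕ) : ℝ) = n - 1 by rw [Nat.cast_sub (by omega), Nat.cast_one]]
  have h1 : (0 : ℝ) < (2 * h) ^ (((n : ℝ) + 1) / 2) := by positivity
  have h2 : 0 < √k := Real.sqrt_pos.2 hk
  rw [show (n : ℝ) - 1 + 1 = n by ring, show (n : ℝ) - 1 + 2 = n + 1 by ring]
  field_simp

lemma Gfun_nonneg (hS : IsSymConvexBody S) {u : Euc n → Euc n} {κ : Euc n → ℝ}
    (hC2 : IsC2Body S u κ) (hκ : ∀ x ∈ frontier S, 0 < κ x) {x : Euc n} (hx : x ∈ frontier S) :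
    0 ≤ Gfun S u κ x := by
  have := inner_outerNormal_pos hS.zero_mem_interior (hC2 _ hx).1
  have := hκ x hx
  unfold Gfun cConst
  positivity

lemma Gfun_pos (hn : 2 ≤ n) (hS : IsSymConvexBody S) {u : Euc n → Euc n} {κ : Euc n → ℝ}
    (hC2 : IsC2Body S u κ) (hκ : ∀ x ∈ frontier S, 0 < κ x) {x : Euc n} (hx : x ∈ frontier S) :
    0 < Gfun S u κ x := by
  refine (Gfun_nonneg hS hC2 hκ hx).lt_of_ne fun h => ?_
  have := bodyCapLimit_mul_rpow hn hS hC2 hκ hx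
  rw [← h, mul_zero, Real.zero_rpow (by positivity), mul_zero] at this
  exact hS.volume_toReal_pos.ne this

lemma bddAbove_Gfun_image (hn : 2 ≤ n) (hS : IsSymConvexBody S) {u : Euc n → Euc n}
    {κ : Euc n → ℝ} (hC2 : IsC2Body S u κ) (hκ : ∀ x ∈ frontier S, 0 < κ x) :
    BddAbove (Gfun S u κ '' frontier S) := by
  obtain ⟨b, hb, hle⟩ := exists_pos_le_bodyCapLimit hn hS hC2 hκ
  have hn0 : (0 : ℝ) < n := by exact_mod_cast (by omega : 0 < n)
  have hV := hS.volume_toReal_pos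
  have hnp : (0 : ℝ) < (n : ℝ) ^ ((2 : ℝ) / (n + 1)) := by positivity
  refine ⟨((volume S).toReal / b) ^ ((2 : ℝ) / (n + 1)) / (n : ℝ) ^ ((2 : ℝ) / (n + 1)), ?_⟩
  rintro _ ⟨x, hx, rfl⟩
  have h0 := Gfun_nonneg hS hC2 hκ hx
  rw [le_div_iff₀' hnp, ← Real.rpow_le_rpow_iff (z := ((n : ℝ) + 1) / 2) (by positivity)
    (by positivity) (by positivity), rpow_two_div_rpow (by positivity), le_div_iff₀' hb,
    ← bodyCapLimit_mul_rpow hn hS hC2 hκ hx]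
  exact mul_le_mul_of_nonneg_right (hle x hx) (by positivity)

lemma eventually_illuminationBody_subset (hn : 2 ≤ n) (hS : IsSymConvexBody S)
    {u : Euc n → Euc n} {κ : Euc n → ℝ} (hC2 : IsC2Body S u κ)
    (hκ : ∀ x ∈ frontier S, 0 < κ x) {a : ℝ}
    (ha : ∀ x ∈ frontier S, (n : ℝ) ^ ((2 : ℝ) / (n + 1)) * Gfun S u κ x < a) :
    ∀ᶠ δ : ℝ in 𝓝[>] 0, illuminationBody S δ ⊆ (1 + a * δ ^ ((2 : ℝ) / (n + 1))) • S := by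
  have hK : IsCompact (frontier S) :=
    hS.1.of_isClosed_subset isClosed_frontier hS.1.isClosed.frontier_subset
  have hG : ∀ x ∈ frontier S, 0 ≤ (n : ℝ) ^ ((2 : ℝ) / (n + 1)) * Gfun S u κ x := fun x hx =>
    mul_nonneg (by positivity) (Gfun_nonneg hS hC2 hκ hx)
  obtain ⟨z, hz⟩ := hS.frontier_nonempty hn
  have ha0 : 0 < a := (hG z hz).trans_lt (ha z hz)
  have haN : 0 < a ^ (((n : ℝ) + 1) / 2) := by positivity
  have hev := (tendsto_sqrt_mul_rpow ha0 n).eventually (eventually_forall_of_isCompact hK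
    (P := fun x r => ENNReal.ofReal ((volume S).toReal / a ^ (((n : ℝ) + 1) / 2) * r ^ (n + 1))
      < volume (convexHull ℝ (S ∪ {(1 + r ^ 2) • x}) \ S))
    fun x₀ hx₀ => eventually_lt_volume hn hS hC2 hκ hx₀
      (B := (volume S).toReal / a ^ (((n : ℝ) + 1) / 2)) (by positivity) (by
        rw [div_lt_iff₀ haN, ← bodyCapLimit_mul_rpow hn hS hC2 hκ hx₀]
        exact mul_lt_mul_of_pos_left (Real.rpow_lt_rpow (hG _ hx₀) (ha _ hx₀) (by positivity))
          (bodyCapLimit_pos hS hC2 hκ hx₀)))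
  filter_upwards [hev, self_mem_nhdsWithin] with δ hδ hδ0
  have hδ0 : 0 < δ := hδ0
  refine hS.illuminationBody_subset_smul hδ0.le (by positivity) fun x hx => ?_
  have := hδ x hx
  rwa [sqrt_mul_rpow_pow_succ ha0.le hδ0.le, ← mul_assoc, div_mul_cancel₀ _ haN.ne',
    Real.sq_sqrt (by positivity)] at this

lemma eventually_subset_illuminationBody (hn : 2 ≤ n) (hS : IsSymConvexBody S)
    {u : Euc n → Euc n} {κ : Euc n → ℝ} (hC2 : IsC2Body S u κ)
    (hκ : ∀ x ∈ frontier S, 0 < κ x) {a : ℝ} (ha0 : 0 < a)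
    (ha : ∀ x ∈ frontier S, a < (n : ℝ) ^ ((2 : ℝ) / (n + 1)) * Gfun S u κ x) :
    ∀ᶠ δ : ℝ in 𝓝[>] 0, (1 + a * δ ^ ((2 : ℝ) / (n + 1))) • S ⊆ illuminationBody S δ := by
  have hK : IsCompact (frontier S) :=
    hS.1.of_isClosed_subset isClosed_frontier hS.1.isClosed.frontier_subset
  have haN : 0 < a ^ (((n : ℝ) + 1) / 2) := by positivity
  have hev := (tendsto_sqrt_mul_rpow ha0 n).eventually (eventually_forall_of_isCompact hK
    (P := fun x r => volume (convexHull ℝ (S ∪ {(1 + r ^ 2) • x}) \ S)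
      < ENNReal.ofReal ((volume S).toReal / a ^ (((n : ℝ) + 1) / 2) * r ^ (n + 1)))
    fun x₀ hx₀ => eventually_volume_lt hn hS hC2 hκ hx₀
      (B := (volume S).toReal / a ^ (((n : ℝ) + 1) / 2)) (by
        rw [lt_div_iff₀ haN, ← bodyCapLimit_mul_rpow hn hS hC2 hκ hx₀]
        exact mul_lt_mul_of_pos_left (Real.rpow_lt_rpow ha0.le (ha _ hx₀) (by positivity))
          (bodyCapLimit_pos hS hC2 hκ hx₀)))
  filter_upwards [hev, self_mem_nhdsWithin] with δ hδ hδ0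
  have hδ0 : 0 < δ := hδ0
  refine hS.smul_subset_illuminationBody hδ0.le fun x hx => ?_
  have := hδ x hx
  rw [sqrt_mul_rpow_pow_succ ha0.le hδ0.le, ← mul_assoc, div_mul_cancel₀ _ haN.ne',
    Real.sq_sqrt (by positivity)] at this
  exact this.le

end Bodies

/-- Proposition 3.4: for `S` of class `C²₊` there is a nonnegative function `Ψ̃` with
`Ψ̃(δ) → 0` such that
`(1 + (1−Ψ̃(δ))n^{2/(n+1)}G_min δ^{2/(n+1)})S ⊆ S^δ ⊆ (1 + (1+Ψ̃(δ))n^{2/(n+1)}G_max δ^{2/(n+1)})S`. -/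
theorem statement7 {n : ℕ} (hn : 2 ≤ n) (S : Set (Euc n))
    (u : Euc n → Euc n) (κ : Euc n → ℝ)
    (hS : IsSymConvexBody S) (hC2 : IsC2Body S u κ)
    (hκ : ∀ x ∈ frontier S, 0 < κ x) :
    ∃ Ψ : ℝ → ℝ, (∀ δ, 0 ≤ Ψ δ) ∧ Tendsto Ψ (𝓝[>] 0) (𝓝 0) ∧
      ∃ δ₀ > (0:ℝ), ∀ δ : ℝ, 0 < δ → δ < δ₀ →
        (1 + (1 - Ψ δ) * (n:ℝ) ^ ((2:ℝ)/(n+1)) * sInf (Gfun S u κ '' frontier S)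
            * δ ^ ((2:ℝ)/(n+1))) • S ⊆ illuminationBody S δ ∧
          illuminationBody S δ ⊆
            (1 + (1 + Ψ δ) * (n:ℝ) ^ ((2:ℝ)/(n+1)) * sSup (Gfun S u κ '' frontier S)
              * δ ^ ((2:ℝ)/(n+1))) • S := by
  have hn0 : (0 : ℝ) < n := by exact_mod_cast (by omega : 0 < n)
  have hnp : (0 : ℝ) < (n : ℝ) ^ ((2 : ℝ) / (n + 1)) := by positivity
  obtain ⟨Ψ, hΨ0, hΨ, hev⟩ := exists_tendsto_zero_of_eventually (P := fun η δ =>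
      (1 + (1 - η) * (n:ℝ) ^ ((2:ℝ)/(n+1)) * sInf (Gfun S u κ '' frontier S)
            * δ ^ ((2:ℝ)/(n+1))) • S ⊆ illuminationBody S δ ∧
          illuminationBody S δ ⊆
            (1 + (1 + η) * (n:ℝ) ^ ((2:ℝ)/(n+1)) * sSup (Gfun S u κ '' frontier S)
              * δ ^ ((2:ℝ)/(n+1))) • S) (by
    intro η hη
    have hle : ∀ x ∈ frontier S, Gfun S u κ x ≤ sSup (Gfun S u κ '' frontier S) := fun x hx =>
      le_csSup (bddAbove_Gfun_image hn hS hC2 hκ) (mem_image_of_mem _ hx)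
    have hge : ∀ x ∈ frontier S, sInf (Gfun S u κ '' frontier S) ≤ Gfun S u κ x := fun x hx =>
      csInf_le ⟨0, forall_mem_image.2 fun y hy => Gfun_nonneg hS hC2 hκ hy⟩ (mem_image_of_mem _ hx)
    have hinf : 0 ≤ sInf (Gfun S u κ '' frontier S) :=
      Real.sInf_nonneg (forall_mem_image.2 fun y hy => Gfun_nonneg hS hC2 hκ hy)
    refine Eventually.and ?_ (eventually_illuminationBody_subset hn hS hC2 hκ fun x hx => ?_)
    · rcases hinf.eq_or_lt with h0 | hpos
      · filter_upwards [self_mem_nhdsWithin] with δ hδ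
        refine hS.smul_subset_illuminationBody (le_of_lt hδ) fun x hx => ?_
        rw [← h0, mul_zero, zero_mul, add_zero, one_smul, union_eq_self_of_subset_right
          (singleton_subset_iff.2 (hS.1.isClosed.frontier_subset hx)), hS.2.1.convexHull_eq,
          sdiff_self]
        simp
      · have hη1 : 0 < 1 - η := by linarith [hη.2]
        refine eventually_subset_illuminationBody hn hS hC2 hκ (by positivity) fun x hx => ?_
        have := mul_le_mul_of_nonneg_left (hge x hx) hnp.le
        nlinarith [mul_pos (mul_pos hη.1 hnp) hpos]
    · have h1 := mul_le_mul_of_nonneg_left (hle x hx) hnp.le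
      have h2 : 0 < sSup (Gfun S u κ '' frontier S) :=
        (Gfun_pos hn hS hC2 hκ hx).trans_le (hle x hx)
      nlinarith [mul_pos (mul_pos hη.1 hnp) h2])
  obtain ⟨δ₀, hδ₀, hsub⟩ := mem_nhdsGT_iff_exists_Ioo_subset.1 hev
  exact ⟨Ψ, hΨ0, hΨ, δ₀, hδ₀, fun δ h1 h2 => hsub ⟨h1, h2⟩⟩
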